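/- Let I be a Cohen-Macaulay R-ideal of positive grade. Then the nonlicci locus of I equals the closed set V(∫I); that is, Nlicci(I) = {p ∈ V(I) : I_p is not licci in R_p} = {p ∈ Spec R : ∫I ⊆ p}. -/

import Mathlib

open RingTheory IsLocalRing

/-- A proper ideal generated by a regular sequence is a complete intersection. -/
def IsCompleteIntersectionIdeal (R : Type) [CommRing R] (I : Ideal R) : Prop :=
  I ≠ ⊤ ∧ ∃ rs : List R, RingTheory.Sequence.IsRegular R rs ∧ Ideal.ofList rs = I

/-- Two proper ideals are directly linked if there is a complete intersection
`c ⊆ I ⊓ J` with `I = c : J` and `J = c : I`. -/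
def IsDirectlyLinked (R : Type) [CommRing R] (I J : Ideal R) : Prop :=
  I ≠ ⊤ ∧ J ≠ ⊤ ∧ ∃ c : Ideal R, IsCompleteIntersectionIdeal R c ∧ c ≤ I ⊓ J ∧
    Submodule.colon c J = I ∧ Submodule.colon c I = J

/-- The linkage (liaison) equivalence: the equivalence relation generated by direct linkage. -/
def InSameLinkageClass (R : Type) [CommRing R] (I J : Ideal R) : Prop :=
  Relation.EqvGen (IsDirectlyLinked R) I J

/-- An ideal is licci if its linkage class contains a complete intersection. -/
def Licci (R : Type) [CommRing R] (I : Ideal R) : Prop :=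
  ∃ J, InSameLinkageClass R I J ∧ IsCompleteIntersectionIdeal R J

open Classical in
/-- `∫ I` : the sum of all ideals in the linkage class of `I` if `I` is not licci,
and the unit ideal otherwise. -/
noncomputable def intLink (R : Type) [CommRing R] (I : Ideal R) : Ideal R :=
  if Licci R I then ⊤ else sSup {J : Ideal R | InSameLinkageClass R I J}

/-- An ideal is maximal in its linkage class if it contains every ideal in its linkage class. -/
def MaximalInLinkageClass (R : Type) [CommRing R] (I : Ideal R) : Prop :=
  ∀ J, InSameLinkageClass R I J → J ≤ I

/-- Linked in `n` steps. -/
def LinkedInSteps (R : Type) [CommRing R] : ℕ → Ideal R → Ideal R → Prop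
  | 0, I, J => I = J
  | (n+1), I, J => ∃ K, IsDirectlyLinked R I K ∧ LinkedInSteps R n K J

/-- The grade of an ideal: the supremum of lengths of regular sequences contained in it. -/
noncomputable def gradeOf (R : Type) [CommRing R] (I : Ideal R) : ℕ :=
  sSup {n : ℕ | ∃ rs : List R, rs.length = n ∧ (∀ r ∈ rs, r ∈ I) ∧
    RingTheory.Sequence.IsRegular R rs}

/-- A Noetherian local ring is Cohen-Macaulay if its depth (the grade of its maximal ideal)
equals its Krull dimension. -/
def IsCMLocalRing (A : Type) [CommRing A] [IsLocalRing A] : Prop :=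
  ringKrullDim A = (gradeOf A (maximalIdeal A) : WithBot (WithTop ℕ))

/-- An ideal `I` of `R` is a Cohen-Macaulay ideal if `R/I` is a Cohen-Macaulay local ring. -/
def IsCMIdeal (R : Type) [CommRing R] (I : Ideal R) : Prop :=
  ∃ h : IsLocalRing (R ⧸ I), @IsCMLocalRing (R ⧸ I) _ h

/-- A Noetherian local ring is Gorenstein if it is Cohen-Macaulay and some ideal generated
by a regular sequence and primary to the maximal ideal is irreducible. -/
def IsGorensteinLocalRing (A : Type) [CommRing A] [IsLocalRing A] : Prop :=
  IsCMLocalRing A ∧ ∃ rs : List A, RingTheory.Sequence.IsRegular A rs ∧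
    (Ideal.ofList rs).radical = maximalIdeal A ∧ InfIrred (Ideal.ofList rs)

open Submodule in
theorem mem_colon_ideal {R : Type} [CommRing R] {A I : Ideal R} {r : R} :
    r ∈ A.colon (I : Set R) ↔ ∀ i ∈ I, r * i ∈ A := by
  simp [Submodule.mem_colon]

/-- Membership in `A ⊔ (a)`. -/
theorem mem_sup_span {R : Type} [CommRing R] {A : Ideal R} {a r : R} :
    r ∈ A ⊔ Ideal.span {a} ↔ ∃ s, r - a * s ∈ A := by
  rw [Submodule.mem_sup]
  constructor
  · rintro ⟨y, hy, z, hz, rfl⟩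
    obtain ⟨s, rfl⟩ := Ideal.mem_span_singleton'.mp hz
    exact ⟨s, by ring_nf; exact hy⟩
  · rintro ⟨s, hs⟩
    exact ⟨_, hs, a * s, Ideal.mem_span_singleton'.mpr ⟨s, mul_comm _ _⟩, by ring⟩

/-- `x` is a nonzerodivisor modulo the ideal `A`. -/
def NzdMod {R : Type} [CommRing R] (A : Ideal R) (x : R) : Prop :=
  ∀ r, x * r ∈ A → r ∈ A

/-- The list is a weakly regular sequence modulo the ideal `A`. -/
def RegMod {R : Type} [CommRing R] : Ideal R → List R → Prop
  | _, [] => True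
  | A, x :: xs => NzdMod A x ∧ RegMod (A ⊔ Ideal.span {x}) xs

section RegMod

variable {R : Type} [CommRing R]

theorem nzdMod_iff_isSMulRegular {A : Ideal R} {x : R} :
    NzdMod A x ↔ IsSMulRegular (R ⧸ A) x := by
  rw [isSMulRegular_iff_right_eq_zero_of_smul]
  constructor
  · intro h y hy
    obtain ⟨r, rfl⟩ := Ideal.Quotient.mk_surjective y
    rw [Ideal.Quotient.eq_zero_iff_mem]
    apply h
    rw [← smul_eq_mul, ← Ideal.Quotient.eq_zero_iff_mem]
    exact hy
  · intro h r hr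
    rw [← Ideal.Quotient.eq_zero_iff_mem]
    apply h
    rw [← smul_eq_mul, ← Ideal.Quotient.eq_zero_iff_mem] at hr
    exact hr

theorem regMod_iff_isWeaklyRegular {A : Ideal R} {xs : List R} :
    RegMod A xs ↔ RingTheory.Sequence.IsWeaklyRegular (R ⧸ A) xs := by
  induction xs generalizing A with
  | nil => simp [RegMod]
  | cons x xs ih =>
    rw [RegMod, RingTheory.Sequence.isWeaklyRegular_cons_iff, nzdMod_iff_isSMulRegular, ih]
    refine and_congr_right fun _ => LinearEquiv.isWeaklyRegular_congr ?_ _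
    refine (Submodule.quotientQuotientEquivQuotientSup A (Ideal.span {x})).symm ≪≫ₗ
      Submodule.quotEquivOfEq _ _ ?_
    rw [← Submodule.ideal_span_singleton_smul x (⊤ : Submodule R (R ⧸ A)),
      ← Submodule.range_mkQ A, ← Submodule.map_top, ← Submodule.map_smul'']
    simp

theorem regMod_bot_iff {xs : List R} :
    RegMod ⊥ xs ↔ RingTheory.Sequence.IsWeaklyRegular R xs := by
  rw [regMod_iff_isWeaklyRegular]
  exact LinearEquiv.isWeaklyRegular_congr (Submodule.quotEquivOfEqBot ⊥ rfl) _

theorem regMod_append {A : Ideal R} {xs ys : List R} :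
    RegMod A (xs ++ ys) ↔ RegMod A xs ∧ RegMod (A ⊔ Ideal.ofList xs) ys := by
  induction xs generalizing A with
  | nil => simp [RegMod]
  | cons x xs ih =>
    simp only [List.cons_append, RegMod, ih, Ideal.ofList_cons, sup_assoc, and_assoc]

theorem regMod_concat {A : Ideal R} {xs : List R} {x : R} :
    RegMod A (xs ++ [x]) ↔ RegMod A xs ∧ NzdMod (A ⊔ Ideal.ofList xs) x := by
  simp [regMod_append, RegMod]

theorem ofList_le {xs : List R} {I : Ideal R} : Ideal.ofList xs ≤ I ↔ ∀ x ∈ xs, x ∈ I := by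
  rw [Ideal.ofList, Ideal.span_le]; rfl

theorem NzdMod.pow {A : Ideal R} {x : R} (h : NzdMod A x) (n : ℕ) : NzdMod A (x ^ n) := by
  induction n with
  | zero => intro r; simp
  | succ n ih => intro r hr; exact ih _ (h _ (by rwa [← mul_assoc, ← pow_succ']))

theorem nzdMod_of_nzdMod_mem {A I : Ideal R} {x : R} (h : NzdMod A x) (hx : x ∈ I) :
    A.colon (I : Set R) = A := by
  apply le_antisymm
  · intro r hr
    exact h r (by rw [mul_comm]; exact mem_colon_ideal.mp hr x hx)
  · intro r hr
    exact mem_colon_ideal.mpr fun i _ => A.mul_mem_right _ hr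

variable [IsNoetherianRing R]

/-- Prime avoidance for associated primes, together with one further ideal. -/
theorem exists_mem_nzdMod_notMem {A I N : Ideal R}
    (h : ∀ (q : Ideal R) (y : R), q.IsPrime → (∀ r, r ∈ q ↔ r * y ∈ A) → ¬ I ≤ q)
    (h2 : ∀ (q : Ideal R) (y : R), q.IsPrime → (∀ r, r ∈ q ↔ r * y ∈ N) → ¬ I ≤ q)
    {B : Ideal R} (hB : ¬ I ≤ B) :
    ∃ c ∈ I, NzdMod A c ∧ NzdMod N c ∧ c ∉ B := by
  classical
  have key : ∀ {A : Ideal R} {q : Ideal R}, q ∈ associatedPrimes R (R ⧸ A) →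
      q.IsPrime ∧ ∃ y, ∀ r, r ∈ q ↔ r * y ∈ A := by
    intro A q hq
    rw [AssociatedPrimes.mem_iff, isAssociatedPrime_iff] at hq
    obtain ⟨hp, y, hy⟩ := hq
    obtain ⟨y, rfl⟩ := Ideal.Quotient.mk_surjective y
    refine ⟨hp, y, fun r => ?_⟩
    rw [hy, Submodule.mem_colon_singleton, Submodule.mem_bot, ← smul_eq_mul,
      ← Ideal.Quotient.eq_zero_iff_mem]
    rfl
  have nz : ∀ {A : Ideal R} {c : R}, (∀ q ∈ associatedPrimes R (R ⧸ A), c ∉ q) → NzdMod A c := by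
    intro A c hc r hr
    by_contra hrA
    have : c ∈ ⋃ p ∈ associatedPrimes R (R ⧸ A), (p : Set R) := by
      rw [biUnion_associatedPrimes_eq_zero_divisors]
      refine ⟨Ideal.Quotient.mk A r, ?_, ?_⟩
      · rwa [Ne, Ideal.Quotient.eq_zero_iff_mem]
      · rw [← smul_eq_mul, ← Ideal.Quotient.eq_zero_iff_mem] at hr
        exact hr
    simp only [Set.mem_iUnion] at this
    obtain ⟨q, hq, hcq⟩ := this
    exact hc q hq hcq
  let S : Finset (Ideal R) := insert B
    ((associatedPrimes.finite R (R ⧸ A)).toFinset ∪ (associatedPrimes.finite R (R ⧸ N)).toFinset)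
  have hS := (Ideal.subset_union_prime (s := S) (f := id) B B (I := I) (by
    intro i hi hiB _
    simp only [S, Finset.mem_insert, hiB, false_or, Finset.mem_union,
      Set.Finite.mem_toFinset] at hi
    rcases hi with hi | hi
    · exact (key hi).1
    · exact (key hi).1)).not.mpr (by
    rintro ⟨q, hq, hIq⟩
    simp only [S, Finset.mem_insert, Finset.mem_union, Set.Finite.mem_toFinset] at hq
    rcases hq with rfl | hq | hq
    · exact hB hIq
    · obtain ⟨hp, y, hy⟩ := key hq
      exact h q y hp hy hIq
    · obtain ⟨hp, y, hy⟩ := key hq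
      exact h2 q y hp hy hIq)
  rw [Set.not_subset] at hS
  obtain ⟨c, hcI, hc⟩ := hS
  simp only [S, Set.mem_iUnion, Finset.coe_insert, Finset.coe_union, Set.Finite.coe_toFinset,
    Set.mem_insert_iff, Set.mem_union, id, not_exists] at hc
  exact ⟨c, hcI, nz fun q hq => hc q (Or.inr (Or.inl hq)), nz fun q hq => hc q (Or.inr (Or.inr hq)),
    hc B (Or.inl rfl)⟩

theorem exists_mem_nzdMod {A N I : Ideal R} (hA : A.colon (I : Set R) = A)
    (hN : N.colon (I : Set R) = N) : ∃ c ∈ I, NzdMod A c ∧ NzdMod N c := by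
  have key : ∀ {A : Ideal R}, A.colon (I : Set R) = A → ∀ (q : Ideal R) (y : R), q.IsPrime →
      (∀ r, r ∈ q ↔ r * y ∈ A) → ¬ I ≤ q := by
    intro A hA q y hq hy hIq
    have : y ∈ A.colon (I : Set R) :=
      mem_colon_ideal.mpr fun i hi => by rw [mul_comm]; exact (hy i).mp (hIq hi)
    rw [hA] at this
    exact hq.ne_top ((Ideal.eq_top_iff_one _).mpr ((hy 1).mpr (by simpa using this)))
  by_cases hI : I = ⊥
  · subst hI
    have htop : ∀ {A : Ideal R}, A.colon ((⊥ : Ideal R) : Set R) = A → NzdMod A 0 := by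
      intro A hA r _
      rw [← hA]
      exact mem_colon_ideal.mpr fun i hi => by simp [Ideal.mem_bot.mp hi]
    exact ⟨0, Ideal.zero_mem _, htop hA, htop hN⟩
  obtain ⟨c, hc, h1, h2, -⟩ := exists_mem_nzdMod_notMem (key hA) (key hN) (B := ⊥)
    (fun h => hI (le_bot_iff.mp h))
  exact ⟨c, hc, h1, h2⟩

variable [IsLocalRing R]

theorem regMod_swap {A : Ideal R} {a b : R} (ha : a ∈ maximalIdeal R) {l : List R}
    (h : RegMod A (a :: b :: l)) : RegMod A (b :: a :: l) := by
  obtain ⟨h1, h2, h3⟩ := h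
  have hb : NzdMod A b := by
    let N : Ideal R := A.colon {b}
    have hN : ∀ r, r ∈ N ↔ r * b ∈ A := fun r => Submodule.mem_colon_singleton
    have hle : N ≤ A := by
      refine Submodule.le_of_le_smul_of_le_jacobson_bot (I := Ideal.span {a})
        (IsNoetherian.noetherian N) ?_ ?_
      · refine le_trans ?_ (IsLocalRing.maximalIdeal_le_jacobson _)
        rwa [Ideal.span_singleton_le_iff_mem]
      · intro r hr
        rw [hN] at hr
        obtain ⟨s, hs⟩ := mem_sup_span.mp
          (h2 r ((le_sup_left : A ≤ A ⊔ Ideal.span {a}) (by rwa [mul_comm])))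
        have hsN : s ∈ N := by
          rw [hN]
          apply h1
          have := A.sub_mem hr (A.mul_mem_right b hs)
          ring_nf at this ⊢
          exact this
        rw [show r = (r - a * s) + a * s by ring]
        refine Submodule.add_mem_sup hs ?_
        rw [← smul_eq_mul]
        exact Submodule.smul_mem_smul (Ideal.mem_span_singleton_self a) hsN
    intro r hr
    exact hle ((hN r).mpr (by rwa [mul_comm]))
  refine ⟨hb, ?_, ?_⟩
  · intro r hr
    obtain ⟨s, hs⟩ := mem_sup_span.mp hr
    have : b * s ∈ A ⊔ Ideal.span {a} := mem_sup_span.mpr ⟨r, by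
      have := A.neg_mem hs
      ring_nf at this ⊢
      exact this⟩
    obtain ⟨t, ht⟩ := mem_sup_span.mp (h2 s this)
    refine mem_sup_span.mpr ⟨t, h1 _ ?_⟩
    have := A.add_mem hs (A.mul_mem_left b ht)
    ring_nf at this ⊢
    exact this
  · rwa [sup_assoc, sup_comm (Ideal.span {b}), ← sup_assoc]

theorem regMod_perm {xs ys : List R} (h : xs.Perm ys) : ∀ {A : Ideal R},
    (∀ x ∈ xs, x ∈ maximalIdeal R) → RegMod A xs → RegMod A ys := by
  induction h with
  | nil => intros; trivial
  | cons x _ ih =>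
    intro A hm hr
    exact ⟨hr.1, ih (fun y hy => hm y (List.mem_cons_of_mem _ hy)) hr.2⟩
  | swap x y l =>
    intro A hm hr
    exact regMod_swap (hm _ (by simp)) hr
  | trans h1 _ ih1 ih2 =>
    intro A hm hr
    exact ih2 (fun x hx => hm x (h1.mem_iff.mpr hx)) (ih1 hm hr)

theorem regMod_concat_of_cons {A : Ideal R} {xs : List R} {x : R}
    (hm : ∀ y ∈ x :: xs, y ∈ maximalIdeal R) (h : RegMod A (x :: xs)) : RegMod A (xs ++ [x]) :=
  regMod_perm (List.perm_append_singleton x xs).symm hm h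

theorem regMod_cons_of_concat {A : Ideal R} {xs : List R} {x : R}
    (hm : ∀ y ∈ x :: xs, y ∈ maximalIdeal R) (h : RegMod A (xs ++ [x])) : RegMod A (x :: xs) :=
  regMod_perm (List.perm_append_singleton x xs) (fun y hy => hm y (by simpa [or_comm] using hy)) h

theorem RegMod.cons_pow {A : Ideal R} {xs : List R} {x : R}
    (hm : ∀ y ∈ x :: xs, y ∈ maximalIdeal R) (h : RegMod A (x :: xs)) (n : ℕ) :
    RegMod A (x ^ (n + 1) :: xs) := by
  have h1 := regMod_concat.mp (regMod_concat_of_cons hm h)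
  refine regMod_cons_of_concat ?_ (regMod_concat.mpr ⟨h1.1, h1.2.pow (n + 1)⟩)
  intro y hy
  rcases List.mem_cons.mp hy with rfl | hy
  · exact Ideal.pow_mem_of_mem _ (hm x (by simp)) _ n.succ_pos
  · exact hm y (List.mem_cons_of_mem _ hy)

theorem RegMod.map_pow {A : Ideal R} {xs : List R}
    (hm : ∀ y ∈ xs, y ∈ maximalIdeal R) (h : RegMod A xs) (n : ℕ) :
    RegMod A (xs.map (· ^ (n + 1))) := by
  induction xs generalizing A with
  | nil => trivial
  | cons x xs ih =>
    have hm' : ∀ y ∈ x :: xs.map (· ^ (n + 1)), y ∈ maximalIdeal R := by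
      intro y hy
      rcases List.mem_cons.mp hy with rfl | hy
      · exact hm y (by simp)
      · obtain ⟨z, hz, rfl⟩ := List.mem_map.mp hy
        exact Ideal.pow_mem_of_mem _ (hm z (List.mem_cons_of_mem _ hz)) _ n.succ_pos
    have h1 : RegMod A (x :: xs.map (· ^ (n + 1))) :=
      ⟨h.1, ih (fun y hy => hm y (List.mem_cons_of_mem _ hy)) h.2⟩
    exact h1.cons_pow hm' n

end RegMod

section Connect

variable {R : Type} [CommRing R]

theorem mem_sup_span_iff_of_sub_mem {A : Ideal R} {a c j w : R} (ha : NzdMod A a)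
    (hc : NzdMod A c) (h : a * w - c * j ∈ A) :
    w ∈ A ⊔ Ideal.span {c} ↔ j ∈ A ⊔ Ideal.span {a} := by
  rw [mem_sup_span, mem_sup_span]
  constructor
  · rintro ⟨s, hs⟩
    refine ⟨s, hc _ ?_⟩
    have := A.sub_mem (A.mul_mem_left a hs) h
    ring_nf at this ⊢
    exact this
  · rintro ⟨s, hs⟩
    refine ⟨s, ha _ ?_⟩
    have := A.add_mem (A.mul_mem_left c hs) h
    ring_nf at this ⊢
    exact this

theorem exists_mem_colon_sub_mem {A I : Ideal R} {a c j : R} (hcI : c ∈ I)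
    (ha : NzdMod A a) (hj : j ∈ (A ⊔ Ideal.span {a}).colon (I : Set R)) :
    ∃ w ∈ (A ⊔ Ideal.span {c}).colon (I : Set R), a * w - c * j ∈ A := by
  rw [mem_colon_ideal] at hj
  obtain ⟨w, hw⟩ := mem_sup_span.mp (hj c hcI)
  refine ⟨w, mem_colon_ideal.mpr fun i hi => ?_, ?_⟩
  · obtain ⟨v, hv⟩ := mem_sup_span.mp (hj i hi)
    refine mem_sup_span.mpr ⟨v, ha _ ?_⟩
    have := A.sub_mem (A.mul_mem_left c hv) (A.mul_mem_left i hw)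
    ring_nf at this ⊢
    exact this
  · have := A.neg_mem hw
    ring_nf at this ⊢
    exact this

theorem colon_ne_step {A I : Ideal R} {a c : R} (hcI : c ∈ I)
    (ha : NzdMod A a) (hc : NzdMod A c)
    (h : (A ⊔ Ideal.span {a}).colon (I : Set R) ≠ A ⊔ Ideal.span {a}) :
    (A ⊔ Ideal.span {c}).colon (I : Set R) ≠ A ⊔ Ideal.span {c} := by
  intro h2
  apply h
  refine le_antisymm (fun j hj => ?_) Ideal.le_colon
  obtain ⟨w, hw, hwj⟩ := exists_mem_colon_sub_mem hcI ha hj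
  rw [h2] at hw
  exact (mem_sup_span_iff_of_sub_mem ha hc hwj).mp hw

theorem colon_colon_step {A I : Ideal R} {a c : R} (hcI : c ∈ I)
    (ha : NzdMod A a) (hc : NzdMod A c)
    (h : (A ⊔ Ideal.span {a}).colon
      (((A ⊔ Ideal.span {a}).colon (I : Set R) : Ideal R) : Set R) ≤ I) :
    (A ⊔ Ideal.span {c}).colon
      (((A ⊔ Ideal.span {c}).colon (I : Set R) : Ideal R) : Set R) ≤ I := by
  intro y hy
  rw [mem_colon_ideal] at hy
  refine h (mem_colon_ideal.mpr fun j hj => ?_)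
  obtain ⟨w, hw, hwj⟩ := exists_mem_colon_sub_mem hcI ha hj
  refine (mem_sup_span_iff_of_sub_mem (w := y * w) ha hc ?_).mp (hy w hw)
  have := A.mul_mem_left y hwj
  ring_nf at this ⊢
  exact this

/-- The module `(A : I) / A` has simple or zero socle, in the sense that any nonzero
element of it generates it. -/
def ColonSimple (I A : Ideal R) : Prop :=
  ∀ x ∈ A.colon (I : Set R), ∀ y ∈ A.colon (I : Set R), y ∉ A → x ∈ A ⊔ Ideal.span {y}

theorem colonSimple_step {A I : Ideal R} {a c : R} (haI : a ∈ I)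
    (ha : NzdMod A a) (hc : NzdMod A c) (h : ColonSimple I (A ⊔ Ideal.span {a})) :
    ColonSimple I (A ⊔ Ideal.span {c}) := by
  intro x hx y hy hyA
  obtain ⟨j, hj, hxj⟩ := exists_mem_colon_sub_mem haI hc hx
  obtain ⟨k, hk, hyk⟩ := exists_mem_colon_sub_mem haI hc hy
  have hkA : k ∉ A ⊔ Ideal.span {a} :=
    fun hk => hyA ((mem_sup_span_iff_of_sub_mem hc ha hyk).mp hk)
  obtain ⟨r, hr⟩ := mem_sup_span.mp (h j hj k hk hkA)
  refine mem_sup_span.mpr ⟨r, ?_⟩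
  refine (mem_sup_span_iff_of_sub_mem hc ha (w := j - k * r) ?_).mp hr
  have := A.sub_mem hxj (A.mul_mem_right r hyk)
  ring_nf at this ⊢
  exact this

variable [IsNoetherianRing R] [IsLocalRing R]

/-- A property of ideals generated by regular sequences in `I` which is preserved when the last
element of the sequence is changed does not depend on the sequence. -/
theorem regMod_connect {I : Ideal R} (hI : I ≤ maximalIdeal R) {P : Ideal R → Prop}
    (hstep : ∀ A a c, a ∈ I → c ∈ I → NzdMod A a → NzdMod A c →
      P (A ⊔ Ideal.span {a}) → P (A ⊔ Ideal.span {c})) :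
    ∀ (n : ℕ) (A : Ideal R) (as bs : List R), as.length = n → bs.length = n →
      (∀ x ∈ as, x ∈ I) → (∀ x ∈ bs, x ∈ I) → RegMod A as → RegMod A bs →
      P (A ⊔ Ideal.ofList as) → P (A ⊔ Ideal.ofList bs) := by
  intro n
  induction n with
  | zero =>
    intro A as bs ha hb _ _ _ _ h
    rw [List.length_eq_zero_iff] at ha hb
    rwa [hb, ← ha]
  | succ n ih =>
    intro A as bs ha hb haI hbI hra hrb h
    have hane : as ≠ [] := by rintro rfl; simp at ha
    have hbne : bs ≠ [] := by rintro rfl; simp at hb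
    obtain ⟨as, a, rfl⟩ : ∃ as' a, as = as' ++ [a] :=
      ⟨_, _, (List.dropLast_append_getLast hane).symm⟩
    obtain ⟨bs, b, rfl⟩ : ∃ bs' b, bs = bs' ++ [b] :=
      ⟨_, _, (List.dropLast_append_getLast hbne).symm⟩
    simp only [List.length_append, List.length_singleton, Nat.add_right_cancel_iff] at ha hb
    simp only [List.mem_append, List.mem_singleton, or_imp, forall_and, forall_eq] at haI hbI
    rw [regMod_concat] at hra hrb
    rw [Ideal.ofList_append, Ideal.ofList_singleton, ← sup_assoc] at h ⊢
    obtain ⟨c, hcI, hca, hcb⟩ := exists_mem_nzdMod (nzdMod_of_nzdMod_mem hra.2 haI.2)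
      (nzdMod_of_nzdMod_mem hrb.2 hbI.2)
    have key : ∀ ds : List R, (∀ x ∈ ds, x ∈ I) → RegMod A ds →
        NzdMod (A ⊔ Ideal.ofList ds) c → RegMod (A ⊔ Ideal.span {c}) ds := by
      intro ds hd hr hc
      refine (regMod_cons_of_concat (fun y hy => hI ?_) (regMod_concat.mpr ⟨hr, hc⟩)).2
      rcases List.mem_cons.mp hy with rfl | hy
      · exact hcI
      · exact hd y hy
    have h1 := hstep _ _ _ haI.2 hcI hra.2 hca h
    rw [sup_right_comm] at h1
    have h2 := ih (A ⊔ Ideal.span {c}) as bs ha hb haI.1 hbI.1 (key as haI.1 hra.1 hca)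
      (key bs hbI.1 hrb.1 hcb) h1
    rw [sup_right_comm] at h2
    exact hstep _ _ _ hcI hbI.2 hcb hrb.2 h2

theorem colon_eq_of_length_lt {A I : Ideal R} (hI : I ≤ maximalIdeal R) {as bs : List R}
    (haI : ∀ x ∈ as, x ∈ I) (hbI : ∀ x ∈ bs, x ∈ I) (ha : RegMod A as) (hb : RegMod A bs)
    (hlt : as.length < bs.length) :
    (A ⊔ Ideal.ofList as).colon (I : Set R) = A ⊔ Ideal.ofList as := by
  by_contra hne
  have hsplit : bs = bs.take as.length ++ bs.drop as.length := (List.take_append_drop _ _).symm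
  rw [List.drop_eq_getElem_cons hlt] at hsplit
  rw [hsplit, regMod_append] at hb
  refine regMod_connect hI (P := fun B => B.colon (I : Set R) ≠ B)
    (fun A a c _ h2 h3 h4 => colon_ne_step h2 h3 h4) as.length A as (bs.take as.length) rfl
    (by simp [hlt.le]) haI (fun x hx => hbI x (List.mem_of_mem_take hx)) ha hb.1 hne ?_
  exact nzdMod_of_nzdMod_mem hb.2.1 (hbI _ (List.getElem_mem hlt))

theorem exists_regMod_concat {A I : Ideal R} (hI : I ≤ maximalIdeal R) {as bs : List R}
    (haI : ∀ x ∈ as, x ∈ I) (hbI : ∀ x ∈ bs, x ∈ I) (ha : RegMod A as) (hb : RegMod A bs)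
    (hlt : as.length < bs.length) :
    ∃ c ∈ I, NzdMod (A ⊔ Ideal.ofList as) c := by
  have h := colon_eq_of_length_lt hI haI hbI ha hb hlt
  obtain ⟨c, hc, h1, -⟩ := exists_mem_nzdMod h h
  exact ⟨c, hc, h1⟩

/-- Two regular sequences in `I` both of which are maximal have the same length. -/
theorem length_eq_of_colon_ne {A I : Ideal R} (hI : I ≤ maximalIdeal R) {as bs : List R}
    (haI : ∀ x ∈ as, x ∈ I) (hbI : ∀ x ∈ bs, x ∈ I) (ha : RegMod A as) (hb : RegMod A bs)
    (hca : (A ⊔ Ideal.ofList as).colon (I : Set R) ≠ A ⊔ Ideal.ofList as)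
    (hcb : (A ⊔ Ideal.ofList bs).colon (I : Set R) ≠ A ⊔ Ideal.ofList bs) :
    as.length = bs.length := by
  rcases lt_trichotomy as.length bs.length with h | h | h
  · exact absurd (colon_eq_of_length_lt hI haI hbI ha hb h) hca
  · exact h
  · exact absurd (colon_eq_of_length_lt hI hbI haI hb ha h) hcb

/-- Every regular sequence can be extended to any length for which a regular sequence exists. -/
theorem exists_regMod_append {A I : Ideal R} (hI : I ≤ maximalIdeal R) {bs : List R}
    (hbI : ∀ x ∈ bs, x ∈ I) (hb : RegMod A bs) :
    ∀ (n : ℕ) (as : List R), (∀ x ∈ as, x ∈ I) → RegMod A as → as.length + n = bs.length →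
      ∃ ys : List R, ys.length = n ∧ (∀ y ∈ ys, y ∈ I) ∧ RegMod (A ⊔ Ideal.ofList as) ys := by
  intro n
  induction n with
  | zero => intro as _ _ _; exact ⟨[], rfl, by simp, trivial⟩
  | succ n ih =>
    intro as haI ha hlen
    obtain ⟨c, hcI, hc⟩ := exists_regMod_concat hI haI hbI ha hb (by omega)
    obtain ⟨ys, hy1, hy2, hy3⟩ := ih (as ++ [c]) (by
      intro x hx
      rcases List.mem_append.mp hx with hx | hx
      · exact haI x hx
      · rwa [List.mem_singleton.mp hx]) (regMod_concat.mpr ⟨ha, hc⟩) (by simp; omega)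
    refine ⟨c :: ys, by simp [hy1], ?_, hc, ?_⟩
    · intro y hy
      rcases List.mem_cons.mp hy with rfl | hy
      · exact hcI
      · exact hy2 y hy
    · rwa [Ideal.ofList_append, Ideal.ofList_singleton, ← sup_assoc] at hy3

end Connect

section Artinian

theorem exists_mem_notMem_forall_maximalIdeal_mul_mem {B : Type} [CommRing B] [IsLocalRing B]
    [IsArtinianRing B] {K K' : Ideal B} (h : K < K') :
    ∃ x ∈ K', x ∉ K ∧ ∀ t ∈ maximalIdeal B, t * x ∈ K := by
  obtain ⟨N, hN⟩ := (isArtinianRing_iff_isNilpotent_maximalIdeal B).mp inferInstance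
  have hN' : maximalIdeal B ^ N * K' ≤ K := by rw [hN]; simp
  clear hN
  induction N with
  | zero =>
    rw [pow_zero, one_mul] at hN'
    exact absurd hN' (not_le_of_gt h)
  | succ n ih =>
    by_cases h1 : maximalIdeal B ^ n * K' ≤ K
    · exact ih h1
    obtain ⟨x, hx, hxK⟩ := SetLike.not_le_iff_exists.mp h1
    refine ⟨x, Ideal.mul_le_right hx, hxK, fun t ht => hN' ?_⟩
    rw [pow_succ', mul_assoc]
    exact Ideal.mul_mem_mul ht hx

theorem mem_annihilator_ideal {B : Type} [CommRing B] {K : Ideal B} {z : B} :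
    z ∈ Submodule.annihilator K ↔ ∀ k ∈ K, z * k = 0 := by
  simp [Submodule.mem_annihilator]

theorem height_annihilator_le {B : Type} [CommRing B] [IsLocalRing B] [IsArtinianRing B]
    (hsoc : ∀ x y : B, (∀ t ∈ maximalIdeal B, t * x = 0) → (∀ t ∈ maximalIdeal B, t * y = 0) →
      y ≠ 0 → x ∈ Ideal.span {y})
    {K : Ideal B} {x : B} (hxK : ∀ t ∈ maximalIdeal B, t * x ∈ K) :
    Order.height (Submodule.annihilator K) ≤
      Order.height (Submodule.annihilator (K ⊔ Ideal.span {x})) + 1 := by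
  let f : Submodule.annihilator K →ₗ[B] B :=
    (LinearMap.mulLeft B x).comp (Submodule.subtype _)
  let g : Submodule.annihilator (K ⊔ Ideal.span {x}) →ₗ[B] Submodule.annihilator K :=
    Submodule.inclusion (Submodule.annihilator_mono le_sup_left)
  have hfg : Function.Exact g f.rangeRestrict := by
    rintro ⟨z, hz⟩
    rw [← Subtype.coe_inj]
    change x * z = 0 ↔ _
    constructor
    · intro h
      refine ⟨⟨z, mem_annihilator_ideal.mpr fun k hk => ?_⟩, rfl⟩
      obtain ⟨s, hs⟩ := mem_sup_span.mp hk
      have := mem_annihilator_ideal.mp hz _ hs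
      linear_combination this + s * h
    · rintro ⟨⟨w, hw⟩, h⟩
      obtain rfl : w = z := congrArg Subtype.val h
      rw [mul_comm]
      exact mem_annihilator_ideal.mp hw x (Ideal.mem_sup_right (Ideal.mem_span_singleton_self x))
  have h1 := Module.length_eq_add_of_exact g f.rangeRestrict
    (Submodule.inclusion_injective _) f.surjective_rangeRestrict hfg
  have hs : ∀ y ∈ LinearMap.range f, ∀ t ∈ maximalIdeal B, t * y = 0 := by
    rintro _ ⟨⟨z, hz⟩, rfl⟩ t ht
    change t * (x * z) = 0
    have := mem_annihilator_ideal.mp hz _ (hxK t ht)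
    linear_combination this
  have h2 : Order.height (LinearMap.range f) ≤ (1 : ℕ) := by
    rw [Order.height_le_coe_iff]
    intro T hT
    have : T = ⊥ := by
      by_contra hne
      obtain ⟨y, hy, hy0⟩ := Submodule.exists_mem_ne_zero_of_ne_bot hne
      refine not_le_of_gt hT fun w hw => ?_
      have hw2 := hsoc w y (hs w hw) (hs y (hT.le hy)) hy0
      exact (Ideal.span_singleton_le_iff_mem (I := T)).mpr hy hw2
    rw [this, Order.height_bot]
    simp
  rw [Module.length_submodule, Module.length_submodule, Module.length_submodule] at h1
  rw [h1]
  gcongr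
  exact_mod_cast h2

/-- In an Artinian local ring with simple socle every ideal is an annihilator. -/
theorem annihilator_annihilator_le_of_socle {B : Type} [CommRing B] [IsLocalRing B]
    [IsArtinianRing B]
    (hsoc : ∀ x y : B, (∀ t ∈ maximalIdeal B, t * x = 0) → (∀ t ∈ maximalIdeal B, t * y = 0) →
      y ≠ 0 → x ∈ Ideal.span {y}) (J : Ideal B) :
    Submodule.annihilator (Submodule.annihilator J) ≤ J := by
  have hmono : ∀ K K' : Ideal B, K ≤ K' →
      Order.height (Submodule.annihilator K) + Order.height K ≤
        Order.height (Submodule.annihilator K') + Order.height K' := by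
    intro K K'
    induction K using WellFoundedGT.induction with
    | ind K ih =>
      intro hle
      rcases hle.eq_or_lt with rfl | hlt
      · exact le_rfl
      obtain ⟨x, hxK', hxK, hmx⟩ := exists_mem_notMem_forall_maximalIdeal_mul_mem hlt
      have hlt2 : K < K ⊔ Ideal.span {x} := by
        refine lt_of_le_of_ne le_sup_left fun h => hxK ?_
        rw [h]
        exact Ideal.mem_sup_right (Ideal.mem_span_singleton_self x)
      refine le_trans ?_ (ih _ hlt2 (sup_le hle ((Ideal.span_singleton_le_iff_mem _).mpr hxK')))
      have h3 : Order.height K + 1 ≤ Order.height (K ⊔ Ideal.span {x}) :=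
        Order.add_one_le_of_lt (Submodule.height_strictMono hlt2)
      calc _ ≤ Order.height (Submodule.annihilator (K ⊔ Ideal.span {x})) + 1 + Order.height K := by
            gcongr; exact height_annihilator_le hsoc hmx
        _ = Order.height (Submodule.annihilator (K ⊔ Ideal.span {x})) + (Order.height K + 1) := by
            ring
        _ ≤ _ := by gcongr
  have htot : ∀ K : Ideal B,
      Order.height (Submodule.annihilator K) + Order.height K = Order.height (⊤ : Ideal B) := by
    intro K
    apply le_antisymm
    · refine (hmono K ⊤ le_top).trans ?_
      have : Submodule.annihilator (⊤ : Ideal B) = ⊥ := by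
        rw [eq_bot_iff]
        intro z hz
        simpa using mem_annihilator_ideal.mp hz 1 trivial
      rw [this, Order.height_bot, zero_add]
    · refine le_trans ?_ (hmono ⊥ K bot_le)
      rw [Submodule.annihilator_bot, Order.height_bot, add_zero]
  set J2 := Submodule.annihilator (Submodule.annihilator J) with hJ2
  have hle : J ≤ J2 := fun j hj => mem_annihilator_ideal.mpr fun k hk => by
    rw [mul_comm]; exact mem_annihilator_ideal.mp hk j hj
  have hJ3 : Submodule.annihilator J2 = Submodule.annihilator J := by
    apply le_antisymm (Submodule.annihilator_mono hle)
    exact fun z hz => mem_annihilator_ideal.mpr fun k hk => by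
      rw [mul_comm]
      exact mem_annihilator_ideal.mp hk z hz
  rcases hle.eq_or_lt with h | h
  · exact h.ge
  · exfalso
    have h1 := htot J
    have h2 := htot J2
    rw [hJ3, ← h1] at h2
    have h3 := Submodule.height_strictMono h
    have h4 := (Submodule.height_lt_top (Submodule.annihilator J)).ne
    exact h3.ne' (ENat.add_right_injective_of_ne_top h4 h2)

theorem colon_colon_le_of_colonSimple {R : Type} [CommRing R] [IsLocalRing R] {A : Ideal R}
    (hA : A ≠ ⊤) (hArt : IsArtinianRing (R ⧸ A)) (hs : ColonSimple (maximalIdeal R) A)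
    {J : Ideal R} (hJ : A ≤ J) :
    A.colon ((A.colon (J : Set R) : Ideal R) : Set R) ≤ J := by
  have : Nontrivial (R ⧸ A) := Ideal.Quotient.nontrivial_iff.mpr hA
  have : IsLocalRing (R ⧸ A) :=
    IsLocalRing.of_surjective' (Ideal.Quotient.mk A) Ideal.Quotient.mk_surjective
  have hmk : ∀ {x : R}, Ideal.Quotient.mk A x = 0 ↔ x ∈ A := Ideal.Quotient.eq_zero_iff_mem
  have hmax : ∀ x : R, (∀ t ∈ maximalIdeal (R ⧸ A), t * Ideal.Quotient.mk A x = 0) →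
      x ∈ A.colon (maximalIdeal R : Set R) := by
    intro x hx
    refine mem_colon_ideal.mpr fun i hi => ?_
    rw [← hmk, mul_comm, map_mul]
    refine hx _ ?_
    rw [mem_maximalIdeal, mem_nonunits_iff] at hi ⊢
    intro hu
    obtain ⟨v, hv⟩ := hu.exists_right_inv
    obtain ⟨v, rfl⟩ := Ideal.Quotient.mk_surjective v
    rw [← map_mul, ← map_one (Ideal.Quotient.mk A), Ideal.Quotient.eq] at hv
    have h1 : i * v - 1 ∈ maximalIdeal R := le_maximalIdeal hA hv
    have h2 : i * v ∈ maximalIdeal R := Ideal.mul_mem_right _ _ hi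
    have h3 := (maximalIdeal R).sub_mem h2 h1
    rw [sub_sub_cancel] at h3
    exact (Ideal.ne_top_iff_one _).mp (maximalIdeal.isMaximal R).ne_top h3
  have key := annihilator_annihilator_le_of_socle (B := R ⧸ A) (by
    intro x y hx hy hy0
    obtain ⟨x, rfl⟩ := Ideal.Quotient.mk_surjective x
    obtain ⟨y, rfl⟩ := Ideal.Quotient.mk_surjective y
    obtain ⟨s, h⟩ := mem_sup_span.mp (hs x (hmax x hx) y (hmax y hy) (fun h => hy0 (hmk.mpr h)))
    rw [Ideal.mem_span_singleton']
    refine ⟨Ideal.Quotient.mk A s, ?_⟩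
    rw [← map_mul, Ideal.Quotient.eq, ← neg_mem_iff, neg_sub, mul_comm]
    exact h) (J.map (Ideal.Quotient.mk A))
  intro x hx
  have hx2 : Ideal.Quotient.mk A x ∈ Submodule.annihilator (Submodule.annihilator
      (J.map (Ideal.Quotient.mk A))) := by
    rw [Submodule.mem_annihilator]
    intro z hz
    obtain ⟨z, rfl⟩ := Ideal.Quotient.mk_surjective z
    rw [smul_eq_mul, ← map_mul, hmk]
    refine mem_colon_ideal.mp hx z (mem_colon_ideal.mpr fun j hj => ?_)
    rw [← hmk, map_mul]
    exact Submodule.mem_annihilator.mp hz _ (Ideal.mem_map_of_mem _ hj)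
  obtain ⟨j, hj, hjx⟩ := (Ideal.mem_map_iff_of_surjective _ Ideal.Quotient.mk_surjective).mp
    (key hx2)
  rw [Ideal.Quotient.eq] at hjx
  have := J.sub_mem hj (hJ hjx)
  rwa [sub_sub_cancel] at this

end Artinian

section Dimension

theorem isRegular_iff_regMod {R : Type} [CommRing R] {xs : List R} :
    RingTheory.Sequence.IsRegular R xs ↔ RegMod ⊥ xs ∧ Ideal.ofList xs ≠ ⊤ := by
  rw [RingTheory.Sequence.isRegular_iff, regMod_bot_iff]
  simp [eq_comm]

theorem exists_prime_mem_iff_mul_mem {R : Type} [CommRing R] [IsNoetherianRing R] {A I : Ideal R}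
    (h : A.colon (I : Set R) ≠ A) :
    ∃ (q : Ideal R) (y : R), q.IsPrime ∧ (∀ r, r ∈ q ↔ r * y ∈ A) ∧ I ≤ q := by
  have h2 : ¬ A.colon (I : Set R) ≤ A := fun h2 => h (le_antisymm h2 Ideal.le_colon)
  obtain ⟨y, hy, hyA⟩ := SetLike.not_le_iff_exists.mp h2
  obtain ⟨q, hq, hle⟩ := exists_le_isAssociatedPrime_of_isNoetherianRing R
    (Ideal.Quotient.mk A y) (by rwa [Ne, Ideal.Quotient.eq_zero_iff_mem])
  have hI : ∀ i ∈ I, i ∈ q := by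
    intro i hi
    apply hle
    rw [Submodule.mem_colon_singleton, Submodule.mem_bot]
    have := mem_colon_ideal.mp hy i hi
    rw [mul_comm, ← Ideal.Quotient.eq_zero_iff_mem] at this
    exact this
  rw [isAssociatedPrime_iff] at hq
  obtain ⟨hp, z, hz⟩ := hq
  obtain ⟨z, rfl⟩ := Ideal.Quotient.mk_surjective z
  refine ⟨q, z, hp, fun r => ?_, hI⟩
  rw [hz, Submodule.mem_colon_singleton, Submodule.mem_bot, ← Ideal.Quotient.eq_zero_iff_mem]
  rfl

theorem colon_ne_of_mem_iff_mul_mem {R : Type} [CommRing R] {A q : Ideal R} {y : R}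
    (hq : q ≠ ⊤) (h : ∀ r, r ∈ q ↔ r * y ∈ A) : A.colon (q : Set R) ≠ A := by
  intro h2
  have : y ∈ A.colon (q : Set R) :=
    mem_colon_ideal.mpr fun i hi => by rw [mul_comm]; exact (h i).mp hi
  rw [h2] at this
  exact hq ((Ideal.eq_top_iff_one q).mpr ((h 1).mpr (by rwa [one_mul])))

theorem ringKrullDim_quotient_add_one_le {R : Type} [CommRing R] {q q' : Ideal R} [q.IsPrime]
    (h : q < q') : ringKrullDim (R ⧸ q') + 1 ≤ ringKrullDim (R ⧸ q) := by
  obtain ⟨x, hx, hxq⟩ := SetLike.exists_of_lt h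
  have hx0 : Ideal.Quotient.mk q x ∈ nonZeroDivisors (R ⧸ q) :=
    mem_nonZeroDivisors_of_ne_zero (by rwa [Ne, Ideal.Quotient.eq_zero_iff_mem])
  refine ringKrullDim_succ_le_of_surjective (Ideal.Quotient.factor h.le)
    (Ideal.Quotient.factor_surjective h.le) hx0 ?_
  simpa [Ideal.Quotient.eq_zero_iff_mem] using hx

theorem ringKrullDim_quotient_anti {R : Type} [CommRing R] {q q' : Ideal R}
    (h : q ≤ q') : ringKrullDim (R ⧸ q') ≤ ringKrullDim (R ⧸ q) :=
  ringKrullDim_le_of_surjective _ (Ideal.Quotient.factor_surjective h)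

variable {R : Type} [CommRing R] [IsLocalRing R]

theorem ofList_ne_top {xs : List R} (hm : ∀ x ∈ xs, x ∈ maximalIdeal R) :
    Ideal.ofList xs ≠ ⊤ :=
  ne_top_of_le_ne_top (maximalIdeal.isMaximal R).ne_top (ofList_le.mpr hm)

variable [IsNoetherianRing R]

theorem exists_nat_ringKrullDim : ∃ n : ℕ, ringKrullDim R = n := by
  have h1 : ringKrullDim R ≠ ⊥ := ringKrullDim_ne_bot
  have h2 : ringKrullDim R ≠ ⊤ := ringKrullDim_lt_top.ne
  obtain ⟨a, ha⟩ := WithBot.ne_bot_iff_exists.mp h1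
  rw [← ha] at h2 ⊢
  have h3 : a ≠ ⊤ := fun h => h2 (by rw [h]; rfl)
  obtain ⟨n, rfl⟩ := ENat.ne_top_iff_exists.mp h3
  exact ⟨n, rfl⟩

theorem exists_nat_ringKrullDim_quotient {A : Ideal R} (hA : A ≠ ⊤) :
    ∃ n : ℕ, ringKrullDim (R ⧸ A) = n := by
  have : Nontrivial (R ⧸ A) := Ideal.Quotient.nontrivial_iff.mpr hA
  have : IsLocalRing (R ⧸ A) :=
    IsLocalRing.of_surjective' (Ideal.Quotient.mk A) Ideal.Quotient.mk_surjective
  exact exists_nat_ringKrullDim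

theorem RegMod.ringKrullDim_add_length {xs : List R} (h : RegMod ⊥ xs)
    (hm : ∀ x ∈ xs, x ∈ maximalIdeal R) :
    ringKrullDim (R ⧸ Ideal.ofList xs) + xs.length = ringKrullDim R :=
  ringKrullDim_add_length_eq_ringKrullDim_of_isRegular xs
    (isRegular_iff_regMod.mpr ⟨h, ofList_ne_top hm⟩)

theorem RegMod.length_le_ringKrullDim_quotient (ys : List R) : ∀ {A q : Ideal R}, q.IsPrime →
    A.colon (q : Set R) ≠ A → RegMod A ys → (∀ y ∈ ys, y ∈ maximalIdeal R) →
    (ys.length : WithBot ℕ∞) ≤ ringKrullDim (R ⧸ q) := by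
  induction ys with
  | nil =>
    intro A q hq _ _ _
    obtain ⟨n, hn⟩ := exists_nat_ringKrullDim_quotient hq.ne_top
    rw [hn]
    exact_mod_cast Nat.zero_le n
  | cons y ys ih =>
    rintro A q hq hne ⟨hy, hys⟩ hm
    have hyq : y ∉ q := fun h => hne (nzdMod_of_nzdMod_mem hy h)
    have hne2 : (A ⊔ Ideal.span {y}).colon ((q ⊔ Ideal.span {y} : Ideal R) : Set R) ≠
        A ⊔ Ideal.span {y} := by
      intro heq
      apply hne
      refine le_antisymm ?_ Ideal.le_colon
      refine Submodule.le_of_le_smul_of_le_jacobson_bot (I := Ideal.span {y})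
        (IsNoetherian.noetherian _) ?_ ?_
      · rw [IsLocalRing.jacobson_eq_maximalIdeal ⊥ bot_ne_top,
          Ideal.span_singleton_le_iff_mem]
        exact hm y (by simp)
      · intro r hr
        rw [mem_colon_ideal] at hr
        have h1 : r ∈ (A ⊔ Ideal.span {y}).colon ((q ⊔ Ideal.span {y} : Ideal R) : Set R) := by
          refine mem_colon_ideal.mpr fun i hi => ?_
          obtain ⟨s, hs⟩ := mem_sup_span.mp hi
          refine mem_sup_span.mpr ⟨r * s, ?_⟩
          have := hr _ hs
          convert this using 1
          ring
        rw [heq] at h1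
        obtain ⟨s, hs⟩ := mem_sup_span.mp h1
        have h2 : s ∈ A.colon (q : Set R) := by
          refine mem_colon_ideal.mpr fun i hi => hy _ ?_
          have := A.sub_mem (hr i hi) (A.mul_mem_right i hs)
          convert this using 1
          ring
        rw [Submodule.mem_sup]
        refine ⟨_, hs, y * s, ?_, by ring⟩
        exact Ideal.mul_mem_mul (Ideal.mem_span_singleton_self y) h2
    obtain ⟨q', z, hq', hz, hle⟩ := exists_prime_mem_iff_mul_mem hne2
    have hlt : q < q' := by
      refine lt_of_le_of_ne (le_sup_left.trans hle) fun h => hyq ?_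
      rw [h]
      exact hle (Ideal.mem_sup_right (Ideal.mem_span_singleton_self y))
    have h1 := ih hq' (colon_ne_of_mem_iff_mul_mem hq'.ne_top hz) hys
      fun y' hy' => hm y' (List.mem_cons_of_mem _ hy')
    refine le_trans ?_ (ringKrullDim_quotient_add_one_le hlt)
    rw [List.length_cons, Nat.cast_add, Nat.cast_one]
    gcongr

end Dimension

section Gorenstein

variable {R : Type} [CommRing R] [IsLocalRing R]

/-- An irreducible ideal has simple socle. -/
theorem colonSimple_of_infIrred {A : Ideal R} (hA : InfIrred A) :
    ColonSimple (maximalIdeal R) A := by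
  intro x hx y hy hyA
  by_contra hxy
  have hinf : (A ⊔ Ideal.span {x}) ⊓ (A ⊔ Ideal.span {y}) = A := by
    refine le_antisymm ?_ (le_inf le_sup_left le_sup_left)
    rintro u ⟨hux, huy⟩
    obtain ⟨a, ha⟩ := mem_sup_span.mp hux
    obtain ⟨b, hb⟩ := mem_sup_span.mp huy
    by_cases hu : IsUnit a
    · obtain ⟨v, hv⟩ := hu.exists_right_inv
      refine absurd (mem_sup_span.mpr ⟨b * v, ?_⟩) hxy
      have := A.mul_mem_left v (A.sub_mem hb ha)
      have h2 : x - y * (b * v) = v * (u - y * b - (u - x * a)) := by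
        linear_combination - x * hv
      rwa [h2]
    · have := A.add_mem ha (mem_colon_ideal.mp hx a hu)
      rwa [sub_add_cancel] at this
  rcases hA.2 hinf with h | h
  · refine hxy (Ideal.mem_sup_left ?_)
    rw [← h]
    exact Ideal.mem_sup_right (Ideal.mem_span_singleton_self x)
  · refine hyA ?_
    rw [← h]
    exact Ideal.mem_sup_right (Ideal.mem_span_singleton_self y)

/-- Every ideal containing `A` is closed under the double colon into `A`. -/
def DoubleColon (A : Ideal R) : Prop :=
  ∀ J : Ideal R, A ≤ J → A.colon ((A.colon (J : Set R) : Ideal R) : Set R) ≤ J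

theorem krullDimLE_zero_of_radical_eq {A : Ideal R} (hA : A ≠ ⊤)
    (h : A.radical = maximalIdeal R) : Ring.KrullDimLE 0 (R ⧸ A) := by
  have : Nontrivial (R ⧸ A) := Ideal.Quotient.nontrivial_iff.mpr hA
  have : IsLocalRing (R ⧸ A) :=
    IsLocalRing.of_surjective' (Ideal.Quotient.mk A) Ideal.Quotient.mk_surjective
  refine .mk₀ fun P hP => ?_
  have hle : maximalIdeal (R ⧸ A) ≤ P := by
    intro x hx
    obtain ⟨x, rfl⟩ := Ideal.Quotient.mk_surjective x
    have hx2 : x ∈ A.radical := by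
      rw [h]
      exact fun hu => hx (hu.map _)
    obtain ⟨n, hn⟩ := hx2
    refine hP.mem_of_pow_mem n ?_
    rw [← map_pow, Ideal.Quotient.eq_zero_iff_mem.mpr hn]
    exact P.zero_mem
  rw [← (maximalIdeal.isMaximal (R ⧸ A)).eq_of_le hP.ne_top hle]
  infer_instance

theorem IsGorensteinLocalRing.exists_doubleColon [IsNoetherianRing R]
    (h : IsGorensteinLocalRing R) :
    ∃ rs : List R, (∀ x ∈ rs, x ∈ maximalIdeal R) ∧ RegMod ⊥ rs ∧
      ringKrullDim R = (rs.length : ℕ) ∧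
      ∀ bs : List R, bs.length = rs.length → RegMod ⊥ bs → (∀ x ∈ bs, x ∈ maximalIdeal R) →
        DoubleColon (Ideal.ofList bs) := by
  obtain ⟨-, rs, hreg, hrad, hirr⟩ := h
  obtain ⟨hreg, htop⟩ := isRegular_iff_regMod.mp hreg
  have hm : ∀ x ∈ rs, x ∈ maximalIdeal R := by
    rw [← ofList_le, ← hrad]
    exact Ideal.le_radical
  have hdim : ringKrullDim R = (rs.length : ℕ) := by
    have h1 := Ring.krullDimLE_iff.mp (krullDimLE_zero_of_radical_eq htop hrad)
    obtain ⟨n, hn⟩ := exists_nat_ringKrullDim_quotient htop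
    have h2 := hreg.ringKrullDim_add_length hm
    rw [hn] at h1 h2
    rw [← h2]
    have : n = 0 := by exact_mod_cast le_antisymm h1 (by exact_mod_cast Nat.zero_le n)
    simp [this]
  refine ⟨rs, hm, hreg, hdim, fun bs hlen hbs hbm J hJ => ?_⟩
  have hbtop := ofList_ne_top hbm
  have hart : IsArtinianRing (R ⧸ Ideal.ofList bs) := by
    rw [isArtinianRing_iff_krullDimLE_zero, Ring.krullDimLE_iff]
    obtain ⟨n, hn⟩ := exists_nat_ringKrullDim_quotient hbtop
    have h2 := hbs.ringKrullDim_add_length hbm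
    rw [hn, hdim, hlen] at h2
    rw [hn]
    norm_cast at h2 ⊢
    omega
  have hsimple := regMod_connect le_rfl (P := ColonSimple (maximalIdeal R))
    (fun A a c ha _ h1 h2 => colonSimple_step ha h1 h2) _ ⊥ rs bs rfl hlen hm hbm hreg hbs
    (by rw [bot_sup_eq]; exact colonSimple_of_infIrred hirr)
  rw [bot_sup_eq] at hsimple
  exact colon_colon_le_of_colonSimple hbtop hart hsimple hJ

end Gorenstein

section CohenMacaulay

theorem IsCMIdeal.ne_top {R : Type} [CommRing R] {I : Ideal R} (h : IsCMIdeal R I) : I ≠ ⊤ := by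
  obtain ⟨h, -⟩ := h
  exact Ideal.Quotient.nontrivial_iff.mp h.toNontrivial

variable {R : Type} [CommRing R] [IsLocalRing R] [IsNoetherianRing R]

theorem RegMod.length_le {xs : List R} (h : RegMod ⊥ xs) (hm : ∀ x ∈ xs, x ∈ maximalIdeal R)
    {d : ℕ} (hd : ringKrullDim R = d) : xs.length ≤ d := by
  obtain ⟨n, hn⟩ := exists_nat_ringKrullDim_quotient (ofList_ne_top hm)
  have h2 := h.ringKrullDim_add_length hm
  rw [hn, hd] at h2
  norm_cast at h2
  omega

/-- In a Cohen-Macaulay local ring, ideals generated by regular sequences have no embedded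
primes. -/
theorem RegMod.eq_of_le_of_colon_ne {rs f : List R} (hrm : ∀ x ∈ rs, x ∈ maximalIdeal R)
    (hrs : RegMod ⊥ rs) (hd : ringKrullDim R = (rs.length : ℕ)) (hf : RegMod ⊥ f)
    (hfm : ∀ x ∈ f, x ∈ maximalIdeal R) {q₀ q : Ideal R} (hq₀ : q₀.IsPrime) (hq : q.IsPrime)
    (hne : (Ideal.ofList f).colon (q : Set R) ≠ Ideal.ofList f) (hle : q₀ ≤ q)
    (hfq : Ideal.ofList f ≤ q₀) : q₀ = q := by
  have hlen := hf.length_le hfm hd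
  obtain ⟨ys, hys, hym, hy⟩ :=
    exists_regMod_append le_rfl hrm hrs (rs.length - f.length) f hfm hf (by omega)
  rw [bot_sup_eq] at hy
  have h1 := RegMod.length_le_ringKrullDim_quotient ys hq hne hy hym
  rcases hle.eq_or_lt with h | h
  · exact h
  exfalso
  have h2 := ringKrullDim_quotient_add_one_le h
  have h3 := ringKrullDim_quotient_anti hfq
  have h4 := hf.ringKrullDim_add_length hfm
  obtain ⟨a, ha⟩ := exists_nat_ringKrullDim_quotient hq.ne_top
  obtain ⟨b, hb⟩ := exists_nat_ringKrullDim_quotient hq₀.ne_top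
  obtain ⟨c, hc⟩ := exists_nat_ringKrullDim_quotient (ofList_ne_top hfm)
  rw [ha] at h1 h2
  rw [hb] at h2 h3
  rw [hc] at h3 h4
  rw [hd] at h4
  norm_cast at h1 h2 h3 h4
  omega

/-- An ideal contains a regular sequence that cannot be extended inside the ideal. -/
theorem exists_regMod_colon_ne {I : Ideal R} (hI : I ≤ maximalIdeal R) :
    ∃ as : List R, (∀ x ∈ as, x ∈ I) ∧ RegMod ⊥ as ∧
      (Ideal.ofList as).colon (I : Set R) ≠ Ideal.ofList as := by
  by_contra! hcon
  obtain ⟨d, hd⟩ := exists_nat_ringKrullDim (R := R)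
  have key : ∀ n : ℕ, ∃ as : List R, as.length = n ∧ (∀ x ∈ as, x ∈ I) ∧ RegMod ⊥ as := by
    intro n
    induction n with
    | zero => exact ⟨[], rfl, by simp, trivial⟩
    | succ n ih =>
      obtain ⟨as, hlen, haI, ha⟩ := ih
      have h := hcon as haI ha
      obtain ⟨c, hc, h1, -⟩ := exists_mem_nzdMod h h
      refine ⟨as ++ [c], by simp [hlen], ?_, regMod_concat.mpr ⟨ha, by rwa [bot_sup_eq]⟩⟩
      intro x hx
      rcases List.mem_append.mp hx with hx | hx
      · exact haI x hx
      · rwa [List.mem_singleton.mp hx]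
  obtain ⟨as, hlen, haI, ha⟩ := key (d + 1)
  have := ha.length_le (fun x hx => hI (haI x hx)) hd
  omega

theorem exists_regMod_and_regMod {A N : Ideal R} {bs cs : List R}
    (hbm : ∀ x ∈ bs, x ∈ maximalIdeal R) (hcm : ∀ x ∈ cs, x ∈ maximalIdeal R)
    (hb : RegMod A bs) (hc : RegMod N cs) (n : ℕ) :
    n ≤ bs.length → n ≤ cs.length →
    ∃ xs : List R, xs.length = n ∧ (∀ x ∈ xs, x ∈ maximalIdeal R) ∧ RegMod A xs ∧
      RegMod N xs := by
  induction n with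
  | zero => exact fun _ _ => ⟨[], rfl, by simp, trivial, trivial⟩
  | succ n ih =>
    intro h1 h2
    obtain ⟨xs, hlen, hxm, hxA, hxN⟩ := ih (by omega) (by omega)
    obtain ⟨c, hc, h1, h2⟩ := exists_mem_nzdMod
      (colon_eq_of_length_lt le_rfl hxm hbm hxA hb (by omega))
      (colon_eq_of_length_lt le_rfl hxm hcm hxN hc (by omega))
    refine ⟨xs ++ [c], by simp [hlen], ?_, regMod_concat.mpr ⟨hxA, h1⟩,
      regMod_concat.mpr ⟨hxN, h2⟩⟩
    intro x hx
    rcases List.mem_append.mp hx with hx | hx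
    · exact hxm x hx
    · rwa [List.mem_singleton.mp hx]

theorem IsCMIdeal.exists_regMod {I : Ideal R} (h : IsCMIdeal R I) :
    ∃ cs : List R, (∀ x ∈ cs, x ∈ maximalIdeal R) ∧ RegMod I cs ∧
      ringKrullDim (R ⧸ I) = (cs.length : ℕ) := by
  obtain ⟨hloc, hCM⟩ := h
  obtain ⟨n, hn⟩ := exists_nat_ringKrullDim (R := R ⧸ I)
  have hmem := Nat.sSup_mem (s := {n : ℕ | ∃ rs : List (R ⧸ I), rs.length = n ∧
      (∀ r ∈ rs, r ∈ maximalIdeal (R ⧸ I)) ∧ RingTheory.Sequence.IsRegular (R ⧸ I) rs})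
    ⟨0, [], rfl, by simp, isRegular_iff_regMod.mpr ⟨trivial, ofList_ne_top (by simp)⟩⟩ (by
      refine ⟨n, ?_⟩
      rintro _ ⟨rs, rfl, hm, hrs⟩
      exact (isRegular_iff_regMod.mp hrs).1.length_le hm hn)
  obtain ⟨rs, hlen, hm, hrs⟩ := hmem
  obtain ⟨cs, rfl⟩ : ∃ cs : List R, cs.map (algebraMap R (R ⧸ I)) = rs :=
    List.map_surjective_iff.mpr Ideal.Quotient.mk_surjective rs
  refine ⟨cs, fun x hx hu => ?_, ?_, ?_⟩
  · exact hm _ (List.mem_map_of_mem hx) (hu.map _)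
  · rw [regMod_iff_isWeaklyRegular,
      ← RingTheory.Sequence.isWeaklyRegular_map_algebraMap_iff (R ⧸ I)]
    exact hrs.toIsWeaklyRegular
  · rw [List.length_map] at hlen
    rw [hlen]
    exact hCM

theorem IsCMIdeal.exists_regMod_and_regMod {I : Ideal R} (h : IsCMIdeal R I) {rs : List R}
    (hrm : ∀ x ∈ rs, x ∈ maximalIdeal R)
    (hrs : RegMod ⊥ rs) (hd : ringKrullDim R = (rs.length : ℕ)) :
    ∃ as xs : List R, (∀ x ∈ as, x ∈ I) ∧ RegMod ⊥ as ∧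
      (∀ x ∈ xs, x ∈ maximalIdeal R) ∧ RegMod (Ideal.ofList as) xs ∧ RegMod I xs ∧
      as.length + xs.length = rs.length := by
  have hI := le_maximalIdeal h.ne_top
  obtain ⟨as, haI, ha, hne⟩ := exists_regMod_colon_ne hI
  obtain ⟨cs, hcm, hcs, hdim⟩ := h.exists_regMod
  have ham : ∀ x ∈ as, x ∈ maximalIdeal R := fun x hx => hI (haI x hx)
  have hlen := ha.length_le ham hd
  obtain ⟨ys, hys, hym, hy⟩ :=
    exists_regMod_append le_rfl hrm hrs (rs.length - as.length) as ham ha (by omega)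
  rw [bot_sup_eq] at hy
  obtain ⟨q, y, hq, hqy, hIq⟩ := exists_prime_mem_iff_mul_mem hne
  have h1 := RegMod.length_le_ringKrullDim_quotient ys hq
    (colon_ne_of_mem_iff_mul_mem hq.ne_top hqy) hy hym
  have h2 := h1.trans (ringKrullDim_quotient_anti hIq)
  rw [hdim] at h2
  norm_cast at h2
  obtain ⟨xs, hxs, hxm, hxa, hxI⟩ :=
    _root_.exists_regMod_and_regMod hym hcm hy hcs ys.length le_rfl h2
  exact ⟨as, xs, haI, ha, hxm, hxa, hxI, by omega⟩

end CohenMacaulay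

section DoubleColon

variable {R : Type} [CommRing R] [IsLocalRing R] [IsNoetherianRing R]

theorem exists_forall_sub_mul_mul_mem {A I : Ideal R} {x z : R}
    (h : ∀ k, ∃ w, ∀ i ∈ I, (z - x * w) * i ∈ A ⊔ maximalIdeal R ^ k) :
    ∃ w, ∀ i ∈ I, (z - x * w) * i ∈ A := by
  classical
  obtain ⟨s, hs⟩ := IsNoetherian.noetherian I
  let φ : R →ₗ[R] (s → R ⧸ A) :=
    LinearMap.pi fun j => LinearMap.toSpanSingleton R (R ⧸ A) (Ideal.Quotient.mk A j)
  have hφ : ∀ r j, φ r j = Ideal.Quotient.mk A (r * j) := fun r j => rfl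
  let N : Submodule R (s → R ⧸ A) := LinearMap.range (φ.comp (LinearMap.mulLeft R x))
  have hbot := Ideal.iInf_pow_smul_eq_bot_of_isLocalRing (M := (s → R ⧸ A) ⧸ N)
    (maximalIdeal R) (maximalIdeal.isMaximal R).ne_top
  have hz : N.mkQ (φ z) ∈ ⨅ k : ℕ, maximalIdeal R ^ k • (⊤ : Submodule R ((s → R ⧸ A) ⧸ N)) := by
    rw [Submodule.mem_iInf]
    intro k
    obtain ⟨w, hw⟩ := h k
    have h1 : N.mkQ (φ z) = N.mkQ (φ (z - x * w)) := by
      rw [← sub_eq_zero, ← map_sub, ← map_sub, sub_sub_cancel, Submodule.mkQ_apply,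
        Submodule.Quotient.mk_eq_zero]
      exact ⟨w, rfl⟩
    rw [h1, ← Submodule.range_mkQ N, ← Submodule.map_top, ← Submodule.map_smul'']
    refine Submodule.mem_map_of_mem ?_
    rw [← Finset.univ_sum_single (φ (z - x * w))]
    refine Submodule.sum_mem _ fun j _ => ?_
    have hj : (j : R) ∈ I := by rw [← hs]; exact Submodule.subset_span j.2
    obtain ⟨a, ha, b, hb, hab⟩ := Submodule.mem_sup.mp (hw j hj)
    have h2 : φ (z - x * w) j = b • (1 : R ⧸ A) := by
      rw [hφ, ← hab, map_add, Ideal.Quotient.eq_zero_iff_mem.mpr ha, zero_add, Algebra.smul_def,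
        mul_one]
      rfl
    rw [h2, Pi.single_smul]
    exact Submodule.smul_mem_smul hb trivial
  rw [hbot, Submodule.mem_bot, Submodule.mkQ_apply, Submodule.Quotient.mk_eq_zero] at hz
  obtain ⟨w, hw⟩ := hz
  refine ⟨w, ?_⟩
  have h3 : I ≤ (A.colon ({z - x * w} : Set R)) := by
    rw [← hs, Submodule.span_le]
    intro j hj
    have h4 := congrFun hw ⟨j, hj⟩
    change Ideal.Quotient.mk A (x * w * j) = Ideal.Quotient.mk A (z * j) at h4
    rw [Ideal.Quotient.eq, ← neg_mem_iff] at h4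
    rw [SetLike.mem_coe, Submodule.mem_colon_singleton, smul_eq_mul]
    convert h4 using 1
    ring
  intro i hi
  have := Submodule.mem_colon_singleton.mp (h3 hi)
  rwa [smul_eq_mul, mul_comm] at this

theorem exists_notMem_sup_pow {I : Ideal R} {y : R} (h : y ∉ I) :
    ∃ k, y ∉ I ⊔ maximalIdeal R ^ k := by
  by_contra! hcon
  obtain ⟨w, hw⟩ := exists_forall_sub_mul_mul_mem (A := I) (I := ⊤) (x := 0) (z := y)
    fun k => ⟨0, fun i _ => by
      rw [mul_zero, sub_zero]; exact Ideal.mul_mem_right _ _ (hcon k)⟩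
  have := hw 1 trivial
  rw [zero_mul, sub_zero, mul_one] at this
  exact h this

/-- Lifting of homomorphisms modulo a regular element into a ring whose artinian reductions
have the double colon property. -/
theorem exists_forall_sub_mul_mul_mem_of_doubleColon {A I : Ideal R} (hAI : A ≤ I) {x : R}
    {ys : List R} (hm : ∀ y ∈ x :: ys, y ∈ maximalIdeal R) (hA : RegMod A (x :: ys))
    (hI : RegMod I (x :: ys))
    (hG : ∀ zs : List R, (∀ y ∈ zs, y ∈ maximalIdeal R) → zs.length = (x :: ys).length →
      RegMod A zs → DoubleColon (A ⊔ Ideal.ofList zs))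
    {z : R} (hz : ∀ i ∈ I, z * i ∈ A ⊔ Ideal.span {x}) :
    ∃ w, ∀ i ∈ I, (z - x * w) * i ∈ A := by
  refine exists_forall_sub_mul_mul_mem fun n => ?_
  set P := Ideal.ofList (ys.map (· ^ (n + 1))) with hP
  set An := A ⊔ Ideal.ofList ((x :: ys).map (· ^ (n + 1))) with hAn
  have hAn' : An = (A ⊔ P) ⊔ Ideal.span {x ^ (n + 1)} := by
    rw [hAn, List.map_cons, Ideal.ofList_cons, hP, sup_assoc, sup_comm (Ideal.span _)]
  have hm' : ∀ y ∈ (x :: ys).map (· ^ (n + 1)), y ∈ maximalIdeal R := by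
    intro y hy
    obtain ⟨t, ht, rfl⟩ := List.mem_map.mp hy
    exact Ideal.pow_mem_of_mem _ (hm t ht) _ (Nat.succ_pos n)
  have hD : DoubleColon An := hG _ hm' (by simp) (hA.map_pow hm n)
  have hle : An ≤ A ⊔ maximalIdeal R ^ n := by
    refine sup_le_sup_left (ofList_le.mpr fun y hy => ?_) _
    obtain ⟨t, ht, rfl⟩ := List.mem_map.mp hy
    exact Ideal.pow_le_pow_right (Nat.le_succ n) (Ideal.pow_mem_pow (hm t ht) _)
  have nzd : ∀ {B : Ideal R}, RegMod B (x :: ys) → NzdMod (B ⊔ P) x := by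
    intro B hB r hr
    have h1 := (regMod_concat.mp (regMod_concat_of_cons (x := x ^ (n + 1)) hm' (hB.map_pow hm n))).2
    refine h1 r ?_
    rw [pow_succ, mul_assoc]
    exact Ideal.mul_mem_left _ _ hr
  set T := An.colon (I : Set R) ⊔ Ideal.span {x} with hT
  have hzT : z ∈ T := by
    refine hD T (le_trans Ideal.le_colon le_sup_left) (mem_colon_ideal.mpr fun u hu => ?_)
    rw [mem_colon_ideal] at hu
    have hux : u * x ∈ An := hu x (Ideal.mem_sup_right (Ideal.mem_span_singleton_self x))
    have huI : u ∈ I ⊔ An := by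
      refine hD _ le_sup_right (mem_colon_ideal.mpr fun r hr => hu r (Ideal.mem_sup_left ?_))
      rw [mem_colon_ideal] at hr ⊢
      exact fun i hi => hr i (Ideal.mem_sup_left hi)
    rw [hAn', mem_sup_span] at hux
    obtain ⟨s, hs⟩ := hux
    have hs' : u - x ^ n * s ∈ A ⊔ P := by
      refine nzd hA _ ?_
      convert hs using 1
      ring
    have huI' : u ∈ (I ⊔ P) ⊔ Ideal.span {x ^ (n + 1)} := by
      refine (sup_le ?_ ?_ : I ⊔ An ≤ _) huI
      · exact le_sup_left.trans le_sup_left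
      · rw [hAn']
        exact sup_le_sup_right (sup_le_sup_right hAI _) _
    obtain ⟨t, ht⟩ := mem_sup_span.mp huI'
    have hv : s - x * t ∈ I ⊔ P := by
      refine (nzd hI).pow n _ ?_
      have := (I ⊔ P).sub_mem ht (sup_le_sup_right hAI P hs')
      convert this using 1
      ring
    obtain ⟨i, hi, p, hp, hip⟩ := Submodule.mem_sup.mp hv
    obtain ⟨c, hc⟩ := mem_sup_span.mp (hz i hi)
    have hAAn : A ≤ An := le_sup_left
    have hPAn : P ≤ An := by rw [hAn']; exact le_sup_right.trans le_sup_left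
    have hAP : A ⊔ P ≤ An := sup_le hAAn hPAn
    have hxAn : x ^ (n + 1) ∈ An := by
      rw [hAn']; exact Ideal.mem_sup_right (Ideal.mem_span_singleton_self _)
    have e : z * u = z * (u - x ^ n * s) + z * x ^ n * p + x ^ n * (z * i - x * c) +
        (c + z * t) * x ^ (n + 1) := by
      linear_combination (-z * x ^ n) * hip
    rw [e]
    refine An.add_mem (An.add_mem (An.add_mem ?_ ?_) ?_) ?_
    · exact An.mul_mem_left _ (hAP hs')
    · exact An.mul_mem_left _ (hPAn hp)
    · exact An.mul_mem_left _ (hAAn hc)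
    · exact An.mul_mem_left _ hxAn
  obtain ⟨w, hw⟩ := mem_sup_span.mp hzT
  exact ⟨w, fun i hi => hle (mem_colon_ideal.mp hw i hi)⟩

theorem colon_colon_le_of_doubleColon (xs : List R) : ∀ {A I : Ideal R}, A ≤ I →
    (∀ y ∈ xs, y ∈ maximalIdeal R) → RegMod A xs → RegMod I xs →
    (∀ zs : List R, (∀ y ∈ zs, y ∈ maximalIdeal R) → zs.length = xs.length →
      RegMod A zs → DoubleColon (A ⊔ Ideal.ofList zs)) →
    A.colon ((A.colon (I : Set R) : Ideal R) : Set R) ≤ I := by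
  induction xs with
  | nil =>
    intro A I hAI _ _ _ hG
    have := hG [] (by simp) rfl trivial
    rw [Ideal.ofList_nil, sup_bot_eq] at this
    exact this I hAI
  | cons x xs ih =>
    intro A I hAI hm hA hI hG y hy
    by_contra hyI
    obtain ⟨n, hn⟩ := exists_notMem_sup_pow hyI
    have hxn : y ∉ I ⊔ Ideal.span {x ^ (n + 1)} := by
      refine fun h => hn (sup_le_sup_left (a := Ideal.span {x ^ (n + 1)}) ?_ I h)
      rw [Ideal.span_singleton_le_iff_mem]
      exact Ideal.pow_le_pow_right (Nat.le_succ n) (Ideal.pow_mem_pow (hm x (by simp)) _)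
    have hA' := hA.cons_pow hm n
    have hI' := hI.cons_pow hm n
    have hxm : x ^ (n + 1) ∈ maximalIdeal R :=
      Ideal.pow_mem_of_mem _ (hm x (by simp)) _ (Nat.succ_pos n)
    have hm2 : ∀ y ∈ xs, y ∈ maximalIdeal R := fun y hy => hm y (List.mem_cons_of_mem _ hy)
    have key := ih (sup_le_sup_right hAI (Ideal.span {x ^ (n + 1)})) hm2 hA'.2 hI'.2
      fun zs hzm hzl hz => by
        have := hG (x ^ (n + 1) :: zs) (List.forall_mem_cons.mpr ⟨hxm, hzm⟩) (by simp [hzl])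
          ⟨hA'.1, hz⟩
        rwa [Ideal.ofList_cons, ← sup_assoc] at this
    refine hxn (key (mem_colon_ideal.mpr fun z hz => ?_))
    rw [mem_colon_ideal] at hz
    obtain ⟨w, hw⟩ := exists_forall_sub_mul_mul_mem_of_doubleColon hAI
      (List.forall_mem_cons.mpr ⟨hxm, hm2⟩) hA' hI'
      (fun zs hzm hzl => hG zs hzm (by simpa using hzl)) fun i hi => hz i (Ideal.mem_sup_left hi)
    refine mem_sup_span.mpr ⟨y * w, ?_⟩
    have := mem_colon_ideal.mp hy _ (mem_colon_ideal.mpr hw)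
    convert this using 1
    ring

/-- A Cohen-Macaulay ideal of a Gorenstein local ring is closed under double colon with respect
to some regular sequence in it. -/
theorem IsCMIdeal.exists_colon_colon_le (hGor : IsGorensteinLocalRing R) {I : Ideal R}
    (h : IsCMIdeal R I) :
    ∃ as : List R, (∀ x ∈ as, x ∈ I) ∧ RegMod ⊥ as ∧
      (Ideal.ofList as).colon (((Ideal.ofList as).colon (I : Set R) : Ideal R) : Set R) ≤ I := by
  obtain ⟨rs, hrm, hrs, hd, hG⟩ := hGor.exists_doubleColon
  obtain ⟨as, xs, haI, ha, hxm, hxa, hxI, hlen⟩ := h.exists_regMod_and_regMod hrm hrs hd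
  refine ⟨as, haI, ha, colon_colon_le_of_doubleColon xs (ofList_le.mpr haI) hxm hxa hxI
    fun zs hzm hzl hz => ?_⟩
  rw [← Ideal.ofList_append]
  refine hG _ (by simp [← hlen, hzl]) (regMod_append.mpr ⟨ha, by rwa [bot_sup_eq]⟩) ?_
  intro x hx
  rcases List.mem_append.mp hx with hx | hx
  · exact le_maximalIdeal h.ne_top (haI x hx)
  · exact hzm x hx

end DoubleColon

section Localize

variable {R : Type} [CommRing R] (p : Ideal R) [p.IsPrime]

/-- The extension of an ideal to the localization at a prime. -/
abbrev localize (I : Ideal R) : Ideal (Localization.AtPrime p) :=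
  I.map (algebraMap R (Localization.AtPrime p))

variable {p}

theorem algebraMap_mem_localize {I : Ideal R} {x : R} :
    algebraMap R (Localization.AtPrime p) x ∈ localize p I ↔ ∃ m, m ∉ p ∧ m * x ∈ I :=
  IsLocalization.algebraMap_mem_map_algebraMap_iff p.primeCompl _ I x

theorem localize_ne_top_iff {I : Ideal R} : localize p I ≠ ⊤ ↔ I ≤ p := by
  rw [localize, IsLocalization.map_algebraMap_ne_top_iff_disjoint p.primeCompl]
  change Disjoint ((p : Set R)ᶜ) I ↔ _
  rw [Set.disjoint_compl_left_iff_subset]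
  rfl

theorem exists_mul_eq_algebraMap (r : Localization.AtPrime p) :
    ∃ u y, IsUnit u ∧ u * r = algebraMap R (Localization.AtPrime p) y := by
  obtain ⟨y, s, rfl⟩ := IsLocalization.exists_mk'_eq p.primeCompl r
  exact ⟨_, y, IsLocalization.map_units _ s, IsLocalization.mk'_spec' _ y s⟩

theorem NzdMod.localize {A : Ideal R} {x : R} (h : NzdMod A x) :
    NzdMod (localize p A) (algebraMap R (Localization.AtPrime p) x) := by
  intro r hr
  obtain ⟨u, y, hu, hy⟩ := exists_mul_eq_algebraMap r
  rw [← Ideal.unit_mul_mem_iff_mem _ hu, hy]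
  have h1 := Ideal.mul_mem_left _ u hr
  rw [mul_left_comm, hy, ← map_mul, algebraMap_mem_localize] at h1
  obtain ⟨m, hm, hmA⟩ := h1
  exact algebraMap_mem_localize.mpr ⟨m, hm, h _ (by rwa [mul_left_comm])⟩

theorem localize_sup_span {A : Ideal R} {x : R} : localize p (A ⊔ Ideal.span {x}) =
    localize p A ⊔ Ideal.span {algebraMap R (Localization.AtPrime p) x} := by
  rw [localize, Ideal.map_sup, Ideal.map_span, Set.image_singleton]

theorem RegMod.localize {A : Ideal R} {xs : List R} (h : RegMod A xs) :
    RegMod (localize p A) (xs.map (algebraMap R (Localization.AtPrime p))) := by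
  induction xs generalizing A with
  | nil => trivial
  | cons x xs ih =>
    refine ⟨h.1.localize, ?_⟩
    rw [← localize_sup_span]
    exact ih h.2

theorem RegMod.localize_bot {xs : List R} (h : RegMod ⊥ xs) :
    RegMod ⊥ (xs.map (algebraMap R (Localization.AtPrime p))) := by
  have := h.localize (p := p)
  rwa [_root_.localize, Ideal.map_bot] at this

theorem localize_colon [IsNoetherianRing R] {A I : Ideal R} :
    localize p (A.colon (I : Set R)) =
      (localize p A).colon ((localize p I : Ideal _) : Set (Localization.AtPrime p)) := by
  apply le_antisymm
  · refine Ideal.map_le_iff_le_comap.mpr fun r hr => mem_colon_ideal.mpr ?_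
    have : localize p I ≤ (localize p A).colon {algebraMap R (Localization.AtPrime p) r} := by
      refine Ideal.map_le_iff_le_comap.mpr fun i hi => ?_
      rw [Ideal.mem_comap, Submodule.mem_colon_singleton, smul_eq_mul, ← map_mul, mul_comm]
      exact Ideal.mem_map_of_mem _ (mem_colon_ideal.mp hr i hi)
    intro i hi
    have := Submodule.mem_colon_singleton.mp (this hi)
    rwa [smul_eq_mul, mul_comm] at this
  · intro r hr
    obtain ⟨u, y, hu, hy⟩ := exists_mul_eq_algebraMap r
    rw [← Ideal.unit_mul_mem_iff_mem _ hu, hy, algebraMap_mem_localize]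
    rw [mem_colon_ideal] at hr
    obtain ⟨s, hs⟩ := IsNoetherian.noetherian I
    have h1 : ∀ i ∈ I, ∃ m, m ∉ p ∧ m * (y * i) ∈ A := by
      intro i hi
      rw [← algebraMap_mem_localize, map_mul, ← hy, mul_assoc]
      exact Ideal.mul_mem_left _ _ (hr _ (Ideal.mem_map_of_mem _ hi))
    choose! m hm using h1
    have hsI : ∀ i ∈ s, i ∈ I := fun i hi => hs ▸ Submodule.subset_span hi
    refine ⟨∏ i ∈ s, m i, ?_, ?_⟩
    · rw [Ideal.IsPrime.prod_mem_iff]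
      rintro ⟨i, hi, hmi⟩
      exact (hm i (hsI i hi)).1 hmi
    · refine mem_colon_ideal.mpr fun i hi => ?_
      have : I ≤ A.colon {(∏ i ∈ s, m i) * y} := by
        rw [← hs, Submodule.span_le]
        intro j hj
        rw [SetLike.mem_coe, Submodule.mem_colon_singleton, smul_eq_mul]
        obtain ⟨c, hc⟩ := Finset.dvd_prod_of_mem m hj
        have := A.mul_mem_left c (hm j (hsI j hj)).2
        rw [hc]
        convert this using 1
        ring
      have := Submodule.mem_colon_singleton.mp (this hi)
      rwa [smul_eq_mul, mul_comm] at this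

theorem IsCompleteIntersectionIdeal.localize {c : Ideal R} (h : IsCompleteIntersectionIdeal R c)
    (hc : c ≤ p) : IsCompleteIntersectionIdeal (Localization.AtPrime p) (localize p c) := by
  obtain ⟨-, rs, hrs, rfl⟩ := h
  have htop := localize_ne_top_iff.mpr hc
  refine ⟨htop, rs.map (algebraMap R _), isRegular_iff_regMod.mpr ⟨?_, ?_⟩, ?_⟩
  · exact (isRegular_iff_regMod.mp hrs).1.localize_bot
  · rwa [← Ideal.map_ofList]
  · rw [← Ideal.map_ofList]

end Localize

section DirectlyLinked

theorem IsDirectlyLinked.symm {R : Type} [CommRing R] {I J : Ideal R}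
    (h : IsDirectlyLinked R I J) : IsDirectlyLinked R J I := by
  obtain ⟨h1, h2, c, hc, hle, h3, h4⟩ := h
  exact ⟨h2, h1, c, hc, by rwa [inf_comm], h4, h3⟩

/-- A property stable under direct linkage is stable on linkage classes. -/
theorem InSameLinkageClass.induction {R : Type} [CommRing R] {P : Ideal R → Prop}
    (hP : ∀ I J, IsDirectlyLinked R I J → P I → P J) {I J : Ideal R}
    (h : InSameLinkageClass R I J) : P I ↔ P J := by
  unfold InSameLinkageClass at h
  induction h with
  | rel I J h => exact ⟨hP I J h, hP J I h.symm⟩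
  | refl I => rfl
  | symm I J _ ih => exact ih.symm
  | trans I J K _ _ ih1 ih2 => exact ih1.trans ih2

theorem IsDirectlyLinked.localize {R : Type} [CommRing R] [IsNoetherianRing R] {p : Ideal R}
    [p.IsPrime] {I J : Ideal R} (h : IsDirectlyLinked R I J) (hI : I ≤ p) (hJ : J ≤ p) :
    IsDirectlyLinked (Localization.AtPrime p) (localize p I) (localize p J) := by
  obtain ⟨-, -, c, hc, hle, h3, h4⟩ := h
  refine ⟨localize_ne_top_iff.mpr hI, localize_ne_top_iff.mpr hJ, _root_.localize p c,
    hc.localize (hle.trans (inf_le_left.trans hI)), ?_, ?_, ?_⟩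
  · exact le_inf (Ideal.map_mono (hle.trans inf_le_left)) (Ideal.map_mono (hle.trans inf_le_right))
  · rw [← localize_colon, h3]
  · rw [← localize_colon, h4]

/-- If the localization of `I` at `p` is not licci, then so is `I`, and the whole linkage class
of `I` is contained in `p`. -/
theorem intLink_le_of_not_licci {R : Type} [CommRing R] [IsNoetherianRing R] {p : Ideal R}
    [p.IsPrime] {I : Ideal R} (hI : I ≤ p)
    (h : ¬ Licci (Localization.AtPrime p) (localize p I)) : intLink R I ≤ p := by
  have key : ∀ J, InSameLinkageClass R I J →
      J ≤ p ∧ InSameLinkageClass (Localization.AtPrime p) (localize p I) (localize p J) := by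
    intro J hJ
    refine (hJ.induction (P := fun J => J ≤ p ∧ InSameLinkageClass (Localization.AtPrime p)
      (localize p I) (localize p J)) ?_).mp ⟨hI, Relation.EqvGen.refl _⟩
    rintro J J' hJJ' ⟨hJp, hlink⟩
    have hJ'p : J' ≤ p := by
      by_contra hnot
      refine h ⟨_, hlink, ?_⟩
      obtain ⟨-, -, c, hc, hle, h3, -⟩ := hJJ'
      have h5 : localize p J' = ⊤ := by
        by_contra h5
        exact hnot (localize_ne_top_iff.mp h5)
      have h6 : localize p J = localize p c := by
        rw [← h3, localize_colon, h5]
        exact Submodule.colon_univ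
      rw [h6]
      exact hc.localize (hle.trans (inf_le_left.trans hJp))
    exact ⟨hJ'p, hlink.trans _ _ _ (Relation.EqvGen.rel _ _ (hJJ'.localize hJp hJ'p))⟩
  have hlicci : ¬ Licci R I := by
    rintro ⟨J, hJ, hCI⟩
    obtain ⟨hJp, hlink⟩ := key J hJ
    exact h ⟨_, hlink, hCI.localize hJp⟩
  rw [intLink, if_neg hlicci]
  exact sSup_le fun J hJ => (key J hJ).1

end DirectlyLinked

section Lift

theorem exists_length_add_one_of_notMem {S : Type} [CommRing S] [IsLocalRing S] {F B : Ideal S}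
    (ts : List S) : ∀ {f : S}, (∀ t ∈ ts, t ∈ B) → f ∈ F ⊔ Ideal.ofList ts →
      f ∉ F ⊔ maximalIdeal S * B →
      ∃ us : List S, us.length + 1 = ts.length ∧ (∀ u ∈ us, u ∈ ts) ∧
        Ideal.ofList ts ≤ F ⊔ Ideal.span {f} ⊔ Ideal.ofList us := by
  induction ts with
  | nil =>
    intro f _ hf hn
    rw [Ideal.ofList_nil, sup_bot_eq] at hf
    exact absurd (Ideal.mem_sup_left hf) hn
  | cons t ts ih =>
    intro f hts hf hn
    rw [Ideal.ofList_cons, sup_comm (Ideal.span {t}), ← sup_assoc] at hf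
    obtain ⟨s, hs⟩ := mem_sup_span.mp hf
    by_cases hu : IsUnit s
    · obtain ⟨v, hv⟩ := hu.exists_right_inv
      refine ⟨ts, rfl, fun u hu => List.mem_cons_of_mem _ hu, ?_⟩
      rw [Ideal.ofList_cons]
      refine sup_le ?_ le_sup_right
      rw [Ideal.span_singleton_le_iff_mem]
      have h1 : f ∈ F ⊔ Ideal.span {f} ⊔ Ideal.ofList ts :=
        Ideal.mem_sup_left (Ideal.mem_sup_right (Ideal.mem_span_singleton_self f))
      have h2 : f - t * s ∈ F ⊔ Ideal.span {f} ⊔ Ideal.ofList ts :=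
        (sup_le_sup_right le_sup_left _ :
          F ⊔ Ideal.ofList ts ≤ F ⊔ Ideal.span {f} ⊔ Ideal.ofList ts) hs
      have h3 := Ideal.mul_mem_left _ v (Ideal.sub_mem _ h1 h2)
      have h4 : t = v * (f - (f - t * s)) := by linear_combination - t * hv
      rwa [h4]
    · have hn' : f - t * s ∉ F ⊔ maximalIdeal S * B := by
        intro h
        have h2 : t * s ∈ F ⊔ maximalIdeal S * B := by
          rw [mul_comm t s]
          exact Ideal.mem_sup_right (Ideal.mul_mem_mul hu (hts t (by simp)))
        have := Ideal.add_mem _ h h2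
        rw [sub_add_cancel] at this
        exact hn this
      obtain ⟨us, hlen, hus, hle⟩ := ih (fun u hu => hts u (List.mem_cons_of_mem _ hu)) hs hn'
      refine ⟨t :: us, by simp [hlen], ?_, ?_⟩
      · intro u hu
        rcases List.mem_cons.mp hu with rfl | hu
        · simp
        · exact List.mem_cons_of_mem _ (hus u hu)
      · have ht : t ∈ F ⊔ Ideal.span {f} ⊔ Ideal.ofList (t :: us) := by
          rw [Ideal.ofList_cons]
          exact Ideal.mem_sup_right (Ideal.mem_sup_left (Ideal.mem_span_singleton_self t))
        rw [Ideal.ofList_cons]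
        refine sup_le ((Ideal.span_singleton_le_iff_mem _).mpr ht) (hle.trans ?_)
        refine sup_le (sup_le (le_sup_left.trans le_sup_left) ?_) ?_
        · rw [Ideal.span_singleton_le_iff_mem]
          exact Ideal.sub_mem _
            (Ideal.mem_sup_left (Ideal.mem_sup_right (Ideal.mem_span_singleton_self f)))
            (Ideal.mul_mem_right _ _ ht)
        · rw [Ideal.ofList_cons]
          exact le_sup_right.trans le_sup_right

theorem isDirectlyLinked_colon {R : Type} [CommRing R] {I : Ideal R} (hI : I ≠ ⊤) {fs : List R}
    (hfI : ∀ x ∈ fs, x ∈ I) (hf : RegMod ⊥ fs)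
    (hcc : (Ideal.ofList fs).colon
      (((Ideal.ofList fs).colon (I : Set R) : Ideal R) : Set R) ≤ I)
    (htop : (Ideal.ofList fs).colon (I : Set R) ≠ ⊤) :
    IsDirectlyLinked R I ((Ideal.ofList fs).colon (I : Set R)) := by
  have hne := ne_top_of_le_ne_top hI (ofList_le.mpr hfI)
  refine ⟨hI, htop, _, ⟨hne, fs, isRegular_iff_regMod.mpr ⟨hf, hne⟩, rfl⟩,
    le_inf (ofList_le.mpr hfI) Ideal.le_colon, le_antisymm hcc fun i hi => ?_, rfl⟩
  exact mem_colon_ideal.mpr fun j hj => by rw [mul_comm]; exact mem_colon_ideal.mp hj i hi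

variable {R : Type} [CommRing R] [IsLocalRing R] [IsNoetherianRing R] {p : Ideal R} [p.IsPrime]

/-- A regular sequence of maximal length in a localization of `I` lifts, up to a change of
generators, to a regular sequence in `I`. -/
theorem exists_regMod_localize_eq {rs : List R} (hrm : ∀ x ∈ rs, x ∈ maximalIdeal R)
    (hrs : RegMod ⊥ rs) (hd : ringKrullDim R = (rs.length : ℕ)) {I : Ideal R} (hI : I ≤ p)
    {as : List R} (haI : ∀ x ∈ as, x ∈ I) (ha : RegMod ⊥ as)
    {bs : List (Localization.AtPrime p)} (hb : RegMod ⊥ bs)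
    (hbI : Ideal.ofList bs ≤ localize p I) (hlen : as.length = bs.length) :
    ∃ fs : List R, (∀ x ∈ fs, x ∈ I) ∧ RegMod ⊥ fs ∧ fs.length = as.length ∧
      localize p (Ideal.ofList fs) = Ideal.ofList bs := by
  have hpm : p ≤ maximalIdeal R := le_maximalIdeal Ideal.IsPrime.ne_top'
  set β := Ideal.ofList bs with hβ
  have hβm : β ≤ maximalIdeal _ :=
    hbI.trans (le_maximalIdeal (localize_ne_top_iff.mpr hI))
  have key : ∀ i ≤ bs.length, ∃ (fs : List R) (ts : List (Localization.AtPrime p)),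
      fs.length = i ∧ i + ts.length = bs.length ∧ (∀ x ∈ fs, x ∈ I) ∧ RegMod ⊥ fs ∧
      localize p (Ideal.ofList fs) ≤ β ∧ (∀ t ∈ ts, t ∈ β) ∧
      β ≤ localize p (Ideal.ofList fs) ⊔ Ideal.ofList ts := by
    intro i
    induction i with
    | zero =>
      exact fun _ => ⟨[], bs, rfl, by simp, by simp, trivial, by simp [localize],
        ofList_le.mp le_rfl, le_sup_right⟩
    | succ i ih =>
      intro hi
      obtain ⟨fs, ts, hfl, htl, hfI, hf, hfβ, htβ, hle⟩ := ih (by omega)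
      set F := Ideal.ofList fs with hF
      have hfp := hf.localize_bot (p := p)
      have hFp : Ideal.ofList (fs.map (algebraMap R (Localization.AtPrime p))) = localize p F :=
        (Ideal.map_ofList _ _).symm
      obtain ⟨γ, hγ, hγF⟩ := exists_regMod_concat hβm (ofList_le.mp (hFp.trans_le hfβ))
        (ofList_le.mp le_rfl) hfp hb (by simpa [hfl] using hi)
      rw [bot_sup_eq, hFp] at hγF
      set b := β.comap (algebraMap R (Localization.AtPrime p)) with hb'
      have hCβ : localize p (I ⊓ b) = β := by
        rw [localize, IsLocalization.map_inf p.primeCompl]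
        have : b.map (algebraMap R (Localization.AtPrime p)) = β :=
          IsLocalization.map_under p.primeCompl _ β
        rw [this]
        exact inf_eq_right.mpr hbI
      have hB : ¬ I ⊓ b ≤ (localize p F ⊔ maximalIdeal _ * β).comap
          (algebraMap R (Localization.AtPrime p)) := by
        intro h
        rw [← Ideal.map_le_iff_le_comap] at h
        have h2 : β ≤ localize p F := by
          refine Submodule.le_of_le_smul_of_le_jacobson_bot (I := maximalIdeal _)
            (IsNoetherian.noetherian _) ?_ (hCβ.symm.trans_le h)
          rw [IsLocalRing.jacobson_eq_maximalIdeal ⊥ bot_ne_top]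
        have h3 := hβm (hfβ (hγF 1 (by rw [mul_one]; exact h2 hγ)))
        exact (maximalIdeal.isMaximal (Localization.AtPrime p)).ne_top
          ((Ideal.eq_top_iff_one _).mpr h3)
      have hass : ∀ (q : Ideal R) (y : R), q.IsPrime → (∀ r, r ∈ q ↔ r * y ∈ F) →
          ¬ I ⊓ b ≤ q := by
        intro q y hq hqy hle
        have hy : y ∉ F := fun h =>
          hq.ne_top ((Ideal.eq_top_iff_one _).mpr ((hqy 1).mpr (by rwa [one_mul])))
        rcases hq.inf_le.mp hle with hIq | hbq
        · obtain ⟨c, hc, hcF⟩ := exists_regMod_concat (hI.trans hpm) hfI haI hf ha (by omega)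
          rw [bot_sup_eq] at hcF
          exact hy (hcF y ((hqy c).mp (hIq hc)))
        · obtain ⟨q₀, hq₀, hq₀q⟩ := Ideal.exists_minimalPrimes_le hbq
          obtain ⟨q', hq', rfl⟩ := Ideal.exists_minimalPrimes_comap_eq _ q₀ hq₀
          have hq'p := hq'.1.1
          have hFb : F ≤ b := Ideal.map_le_iff_le_comap.mp hfβ
          have heq := RegMod.eq_of_le_of_colon_ne hrm hrs hd hf
            (fun x hx => hpm (hI (hfI x hx))) (Ideal.comap_isPrime _ _) hq
            (colon_ne_of_mem_iff_mul_mem hq.ne_top hqy) hq₀q (hFb.trans (Ideal.comap_mono hq'.1.2))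
          have hqp : q ≤ p := by
            rw [← heq]
            intro r hr
            rw [← IsLocalization.AtPrime.to_map_mem_maximal_iff (Localization.AtPrime p) p]
            exact le_maximalIdeal hq'p.ne_top hr
          obtain ⟨u, γ₀, hu, hγ₀⟩ := exists_mul_eq_algebraMap γ
          have hγ₀q : γ₀ ∈ q := by
            apply hbq
            rw [hb', Ideal.mem_comap, ← hγ₀]
            exact Ideal.mul_mem_left _ _ hγ
          have h5 := Ideal.mem_map_of_mem (algebraMap R (Localization.AtPrime p))
            ((hqy γ₀).mp hγ₀q)
          rw [map_mul, ← hγ₀, mul_assoc, Ideal.unit_mul_mem_iff_mem _ hu] at h5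
          obtain ⟨t, ht, hty⟩ := algebraMap_mem_localize.mp (hγF _ h5)
          exact ht (hqp ((hqy t).mpr hty))
      obtain ⟨c, ⟨hcI, hcb⟩, hcF, -, hcB⟩ := exists_mem_nzdMod_notMem hass hass hB
      obtain ⟨us, hul, hut, hus⟩ := exists_length_add_one_of_notMem ts htβ (hle hcb) hcB
      have hnew : localize p (Ideal.ofList (fs ++ [c])) =
          localize p F ⊔ Ideal.span {algebraMap R (Localization.AtPrime p) c} := by
        rw [Ideal.ofList_append, Ideal.ofList_singleton, localize_sup_span]
      refine ⟨fs ++ [c], us, by simp [hfl], by omega, ?_,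
        regMod_concat.mpr ⟨hf, by rwa [bot_sup_eq]⟩, ?_, fun u hu => htβ u (hut u hu), ?_⟩
      · intro x hx
        rcases List.mem_append.mp hx with hx | hx
        · exact hfI x hx
        · rwa [List.mem_singleton.mp hx]
      · rw [hnew]
        exact sup_le hfβ ((Ideal.span_singleton_le_iff_mem _).mpr hcb)
      · rw [hnew]
        exact hle.trans (sup_le (le_sup_left.trans le_sup_left) hus)
  obtain ⟨fs, ts, hfl, htl, hfI, hf, hfβ, -, hle⟩ := key bs.length le_rfl
  obtain rfl : ts = [] := List.length_eq_zero_iff.mp (by omega)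
  rw [Ideal.ofList_nil, sup_bot_eq] at hle
  exact ⟨fs, hfI, hf, by omega, le_antisymm hfβ hle⟩

/-- `I` contains a regular sequence with respect to which it is closed under double colon. -/
def SelfLinkable (I : Ideal R) : Prop :=
  ∃ as : List R, (∀ x ∈ as, x ∈ I) ∧ RegMod ⊥ as ∧
    (Ideal.ofList as).colon (((Ideal.ofList as).colon (I : Set R) : Ideal R) : Set R) ≤ I

theorem SelfLinkable.exists_localize_eq (hGor : IsGorensteinLocalRing R) {I : Ideal R}
    (hI : I ≤ p) (h : SelfLinkable I) {β : Ideal (Localization.AtPrime p)}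
    (hβ : IsCompleteIntersectionIdeal _ β) (hβI : β ≤ localize p I)
    (hne : β.colon ((localize p I : Ideal _) : Set (Localization.AtPrime p)) ≠ β) :
    ∃ fs : List R, (∀ x ∈ fs, x ∈ I) ∧ RegMod ⊥ fs ∧ localize p (Ideal.ofList fs) = β ∧
      (Ideal.ofList fs).colon (((Ideal.ofList fs).colon (I : Set R) : Ideal R) : Set R) ≤ I := by
  obtain ⟨rs, hrm, hrs, hd, -⟩ := hGor.exists_doubleColon
  obtain ⟨as, haI, ha, hcc⟩ := h
  obtain ⟨-, bs, hbs, rfl⟩ := hβ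
  have hb := (isRegular_iff_regMod.mp hbs).1
  have hpm : p ≤ maximalIdeal R := le_maximalIdeal Ideal.IsPrime.ne_top'
  have htop := localize_ne_top_iff.mpr hI
  have hmap : Ideal.ofList (as.map (algebraMap R (Localization.AtPrime p))) =
    localize p (Ideal.ofList as) := (Ideal.map_ofList _ _).symm
  have hlen := length_eq_of_colon_ne (A := ⊥) (le_maximalIdeal htop)
    (ofList_le.mp (hmap.trans_le (Ideal.map_mono (ofList_le.mpr haI)))) (ofList_le.mp hβI)
    ha.localize_bot hb (by
      rw [bot_sup_eq, hmap, ← localize_colon]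
      intro heq
      have h1 := Ideal.map_mono (f := algebraMap R (Localization.AtPrime p)) hcc
      rw [← localize, localize_colon, heq] at h1
      refine htop (top_le_iff.mp (le_trans ?_ h1))
      rw [(Submodule.colon_eq_top_iff_subset _).mpr le_rfl]) (by rwa [bot_sup_eq])
  rw [List.length_map] at hlen
  obtain ⟨fs, hfI, hf, hfl, hfβ⟩ := exists_regMod_localize_eq hrm hrs hd hI haI ha hb hβI hlen
  refine ⟨fs, hfI, hf, hfβ, ?_⟩
  have := regMod_connect (hI.trans hpm)
    (P := fun A => A.colon ((A.colon (I : Set R) : Ideal R) : Set R) ≤ I)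
    (fun A a c _ hc h1 h2 h3 => colon_colon_step hc h1 h2 h3) _ ⊥ as fs rfl hfl haI hfI ha hf
    (by rwa [bot_sup_eq])
  rwa [bot_sup_eq] at this

theorem not_licci_of_intLink_le (hGor : IsGorensteinLocalRing R) {I : Ideal R}
    (hI : SelfLinkable I) (h : intLink R I ≤ p) :
    I ≤ p ∧ ¬ Licci (Localization.AtPrime p) (localize p I) := by
  have hlicci : ¬ Licci R I := by
    intro hl
    rw [intLink, if_pos hl, top_le_iff] at h
    exact Ideal.IsPrime.ne_top' h
  rw [intLink, if_neg hlicci] at h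
  have hle : ∀ J, InSameLinkageClass R I J → J ≤ p := fun J hJ => (le_sSup hJ).trans h
  have hIp := hle I (Relation.EqvGen.refl _)
  refine ⟨hIp, ?_⟩
  rintro ⟨K, hK, hCI⟩
  have hstep : ∀ K K', IsDirectlyLinked (Localization.AtPrime p) K K' →
      (∃ J, InSameLinkageClass R I J ∧ SelfLinkable J ∧ localize p J = K) →
      ∃ J, InSameLinkageClass R I J ∧ SelfLinkable J ∧ localize p J = K' := by
    rintro _ K' ⟨hKtop, hK'top, β, hβ, hβle, hβ1, hβ2⟩ ⟨J, hIJ, hJ, rfl⟩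
    have hJp := hle J hIJ
    have hJtop : J ≠ ⊤ := ne_top_of_le_ne_top Ideal.IsPrime.ne_top' hJp
    obtain ⟨fs, hfJ, hf, rfl, hcc⟩ := hJ.exists_localize_eq hGor hJp hβ
      (hβle.trans inf_le_left) (by
        rw [hβ2]
        rintro rfl
        refine hKtop ?_
        rw [← hβ1]
        exact (Submodule.colon_eq_top_iff_subset _).mpr le_rfl)
    have htop : (Ideal.ofList fs).colon (J : Set R) ≠ ⊤ := by
      intro htop
      rw [← localize_colon, htop] at hβ2
      exact hK'top (by rw [← hβ2]; exact Ideal.map_top _)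
    have hlink := isDirectlyLinked_colon hJtop hfJ hf hcc htop
    refine ⟨_, hIJ.trans _ _ _ (Relation.EqvGen.rel _ _ hlink), ⟨fs, ?_, hf, ?_⟩, ?_⟩
    · exact ofList_le.mp Ideal.le_colon
    · have heq : (Ideal.ofList fs).colon
          (((Ideal.ofList fs).colon (J : Set R) : Ideal R) : Set R) = J := by
        refine le_antisymm hcc fun i hi => mem_colon_ideal.mpr fun j hj => ?_
        rw [mul_comm]
        exact mem_colon_ideal.mp hj i hi
      rw [heq]
    · rw [localize_colon, hβ2]
  obtain ⟨J, hIJ, hJ, rfl⟩ :=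
    (hK.induction hstep).mp ⟨I, Relation.EqvGen.refl _, hI, rfl⟩
  have hJp := hle J hIJ
  have hself : (localize p J).colon ((localize p J : Ideal _) : Set (Localization.AtPrime p)) =
    ⊤ := (Submodule.colon_eq_top_iff_subset _).mpr le_rfl
  obtain ⟨fs, hfJ, hf, hfK, hcc⟩ := hJ.exists_localize_eq hGor hJp hCI le_rfl (by
    rw [hself]
    exact hCI.1.symm)
  have hJtop : J ≠ ⊤ := ne_top_of_le_ne_top Ideal.IsPrime.ne_top' hJp
  by_cases htop : (Ideal.ofList fs).colon (J : Set R) = ⊤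
  · have hJf : J = Ideal.ofList fs :=
      le_antisymm ((Submodule.colon_eq_top_iff_subset _).mp htop) (ofList_le.mpr hfJ)
    refine hlicci ⟨J, hIJ, hJtop, fs, isRegular_iff_regMod.mpr ⟨hf, ?_⟩, hJf.symm⟩
    rwa [← hJf]
  · have hlink := isDirectlyLinked_colon hJtop hfJ hf hcc htop
    have hlep := hle _ (hIJ.trans _ _ _ (Relation.EqvGen.rel _ _ hlink))
    rw [← localize_ne_top_iff, localize_colon, hfK] at hlep
    exact hlep hself

end Lift

/-- Proposition 2.8. Let `I` be a Cohen-Macaulay ideal of positive grade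
in a Noetherian local Gorenstein ring with infinite residue field. Then the nonlicci locus
`Nlicci(I) = {p ∈ V(I) : I_p is not licci in R_p}` equals `V(∫I)`. -/
theorem statement7 (R : Type) [CommRing R] [IsLocalRing R] [IsNoetherianRing R]
    (hGor : IsGorensteinLocalRing R) (hres : Infinite (IsLocalRing.ResidueField R))
    (I : Ideal R) (hCM : IsCMIdeal R I) (hgrade : ∃ r ∈ I, r ∈ nonZeroDivisors R) :
    {p : PrimeSpectrum R | I ≤ p.asIdeal ∧
        ¬ Licci (Localization.AtPrime p.asIdeal)
            (I.map (algebraMap R (Localization.AtPrime p.asIdeal)))} =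
      {p : PrimeSpectrum R | intLink R I ≤ p.asIdeal} := by
  ext q
  exact ⟨fun h => intLink_le_of_not_licci h.1 h.2,
    not_licci_of_intLink_le hGor (hCM.exists_colon_colon_le hGor)⟩
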